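/- Let a ∈ P_m and b ∈ P_n. Let X(a,b) = {(Θ, c', c'') : Θ ∈ R(a,b), and (c', c'') is an ordered pair of subwords of aΘb with F_{c'} ∩ F_{c''} = ∅ and F_{c'} ∪ F_{c''} = F_{aΘb}}, and let Y(a,b) = {(a', a'', b', b'', Θ', Θ'') : (a',a'') is an ordered pair of subwords of a with F_{a'} ∩ F_{a''} = ∅ and F_{a'} ∪ F_{a''} = F_a, (b',b'') is an ordered pair of subwords of b with F_{b'} ∩ F_{b''} = ∅ and F_{b'} ∪ F_{b''} = F_b, Θ' ∈ R(Park(a'), Park(b')), Θ'' ∈ R(Park(a''), Park(b''))}. Then there is a bijection X(a,b) → Y(a,b), (Θ, c', c'') ↦ (a', a'', b', b'', Θ', Θ''), such that Park(c') = Park(a') Θ' Park(b') and Park(c'') = Park(a'') Θ'' Park(b''). -/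

import Mathlib

open scoped Classical

/-- Words on natural numbers (letters are intended to be positive integers). -/
abbrev W : Type := List ℕ

/-- `IsPF a` : the word `a` is a parking function, i.e. all its letters are
positive and its nondecreasing rearrangement `b₁ b₂ ⋯ bₙ` satisfies `bᵢ ≤ i`. -/
def IsPF (a : W) : Prop :=
  (∀ x ∈ a, 1 ≤ x) ∧
    ∀ i, i < a.length → (a.insertionSort (· ≤ ·)).getD i 0 ≤ i + 1

/-- Split a word into the consecutive segments beginning at its
left-to-right minima (in the order in which they occur in the word). -/
def segs : W → List W
  | [] => []
  | x :: xs =>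
      (x :: xs.takeWhile fun y => x ≤ y) :: segs (xs.dropWhile fun y => x ≤ y)
termination_by a => a.length
decreasing_by
  simpa using Nat.lt_succ_of_le (List.dropWhile_sublist _).length_le

/-- The LR-decomposition `F_a` of a word `a`: the sequence of segments beginning
at the left-to-right minima, listed in increasing order of their minimal letters
(i.e. in reverse order of occurrence in `a`). -/
def LR (a : W) : List W := (segs a).reverse

/-- The word `w_k ⋯ w_2 w_1` encoded by an LR-decomposition `(w_1, …, w_k)`. -/
def wordOf (F : List W) : W := F.reverse.flatten

/-- A word is dominated if it is nonempty and its first letter is its minimal letter. -/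
def Dominated (w : W) : Prop := w ≠ [] ∧ ∀ x ∈ w, w.headD 0 ≤ x

/-- The minimal letter of a word (`0` for the empty word). -/
def minW (w : W) : ℕ := (w.min?).getD 0

/-- Add `m` to every letter of a word. -/
def shiftW (m : ℕ) (w : W) : W := w.map (· + m)

/-- Add `m` to every letter of every word of a sequence of words. -/
def shiftF (m : ℕ) (F : List W) : List W := F.map (shiftW m)

/-- The word whose LR-decomposition is the finite set of words `G`:
sort `G` increasingly (for dominated words with distinct minimal letters the
lexicographic order agrees with comparing the minimal letters) and concatenate
in decreasing order. -/
noncomputable def wordOfSet (G : Finset W) : W := (G.sort (· ≤ ·)).reverse.flatten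

/-- Given vertex sets `X`, `Y` (of words) and a set `Θ` of edges, the resulting
set of words: concatenations `u ++ w` over edges `(u, w) ∈ Θ`, together with all
unmatched words of `X` and of `Y`. -/
noncomputable def glueSet (X Y : Finset W) (Θ : Finset (W × W)) : Finset W :=
  Θ.image (fun p => p.1 ++ p.2) ∪
    X.filter (fun u => ∀ p ∈ Θ, p.1 ≠ u) ∪
    Y.filter (fun w => ∀ p ∈ Θ, p.2 ≠ w)

/-- `R(a,b)` : the set of matchings between `F_a` and `F_b + m` (`m` the length
of `a`), encoded as sets of edges in which no vertex occurs twice. -/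
noncomputable def Rset (a b : W) : Finset (Finset (W × W)) :=
  ((LR a).toFinset ×ˢ (shiftF a.length (LR b)).toFinset).powerset.filter
    (fun Θ => ∀ p ∈ Θ, ∀ q ∈ Θ, (p.1 = q.1 ∨ p.2 = q.2) → p = q)

/-- `aΘb` : the parking function whose LR-decomposition consists of the
concatenations `u ⬝ (w + m)` over the edges `(u, w + m)` of `Θ` together with all
unmatched words of `F_a` and of `F_b + m`. -/
noncomputable def mTheta (a b : W) (Θ : Finset (W × W)) : W :=
  wordOfSet (glueSet (LR a).toFinset (shiftF a.length (LR b)).toFinset Θ)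

/-- `d(a) = min { i : #{ j : a_j ≤ i } < i }`. -/
def dVal (a : W) : ℕ :=
  Nat.find (p := fun i => (a.filter (fun x => x ≤ i)).length < i)
    ⟨a.length + 1, Nat.lt_succ_of_le (List.length_filter_le _ _)⟩

/-- One step of the parkization algorithm: decrement every letter greater
than `d(a)`.  (This is the identity when `a` is a parking function.) -/
def parkStep (a : W) : W := a.map fun x => if dVal a < x then x - 1 else x

/-- Auxiliary fueled version of the parkization algorithm. -/
def parkFuel : ℕ → W → W
  | 0, a => a
  | k + 1, a => if dVal a = a.length + 1 then a else parkFuel k (parkStep a)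

/-- The parkization `Park a` of a word `a`.  (For a word with positive letters
the algorithm needs at most `a.sum` steps, so the fuel below suffices.) -/
def Park (a : W) : W := parkFuel a.sum a

/-- The subword of `a` obtained by keeping exactly the words of `F_a`
belonging to `S`. -/
def subWord (a : W) (S : Finset W) : W := wordOf ((LR a).filter (· ∈ S))

/-- The free module with basis indexed by words; the Hopf algebra `PFSym` is
its submodule spanned by `{M_a : a ∈ P}`. -/
abbrev FW (K : Type) [Field K] : Type := W →₀ K

/-- The monomial basis element `M_a`. -/
noncomputable def Mb (K : Type) [Field K] (a : W) : FW K := Finsupp.single a 1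

/-- `M_a ⋆ M_b = Σ_{Θ ∈ R(a,b)} M_{aΘb}` on basis elements. -/
noncomputable def mulSingle (K : Type) [Field K] (a b : W) : FW K :=
  ∑ Θ ∈ Rset a b, Mb K (mTheta a b Θ)

/-- The product `⋆`, extended bilinearly. -/
noncomputable def starF (K : Type) [Field K] (x y : FW K) : FW K :=
  x.sum fun a ca => y.sum fun b cb => (ca * cb) • mulSingle K a b

/-- The free module with basis indexed by pairs of words; it realizes the
tensor square of `FW K` via `M_a ⊗ M_b ↦ single (a,b)`. -/
abbrev FW2 (K : Type) [Field K] : Type := (W × W) →₀ K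

/-- `Δ(M_a) = Σ M_{Park a'} ⊗ M_{Park a''}` over ordered pairs `(a', a'')` of
subwords of `a` with `F_{a'} ⊍ F_{a''} = F_a` (encoded by the subset
`S ⊆ F_a` of words kept in `a'`). -/
noncomputable def deltaSingle (K : Type) [Field K] (a : W) : FW2 K :=
  ∑ S ∈ ((LR a).toFinset).powerset,
    Finsupp.single
      (Park (subWord a S), Park (subWord a (((LR a).toFinset) \ S))) 1

/-- The coproduct `Δ`, extended linearly. -/
noncomputable def deltaF (K : Type) [Field K] (x : FW K) : FW2 K :=
  x.sum fun a ca => ca • deltaSingle K a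

/-- The componentwise product on the tensor square, on basis elements:
`(M_a ⊗ M_b) ⋆ (M_c ⊗ M_d) = (M_a ⋆ M_c) ⊗ (M_b ⋆ M_d)`. -/
noncomputable def star2Single (K : Type) [Field K] (p q : W × W) : FW2 K :=
  ∑ Θ ∈ Rset p.1 q.1, ∑ Θ' ∈ Rset p.2 q.2,
    Finsupp.single (mTheta p.1 q.1 Θ, mTheta p.2 q.2 Θ') 1

/-- The componentwise product on the tensor square, extended bilinearly. -/
noncomputable def star2F (K : Type) [Field K] (x y : FW2 K) : FW2 K :=
  x.sum fun p cp => y.sum fun q cq => (cp * cq) • star2Single K p q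

/-- The counit `ε` on basis elements. -/
noncomputable def epsW (K : Type) [Field K] (a : W) : K := if a = [] then 1 else 0

/-- `F_a ∘ F_b` : concatenate the `i`-th words of `F_a` and `F_b + m`
for `i ≤ min(r,s)` and keep the remaining unpaired words. -/
def splitLR (F G : List W) : List W :=
  List.zipWith (· ++ ·) F G ++ F.drop G.length ++ G.drop F.length

/-- The split product `a ∘ b`. -/
def splitProd (a b : W) : W := wordOf (splitLR (LR a) (shiftF a.length (LR b)))

/-- A nonempty parking function is unsplitable if it is not the split product
of two nonempty parking functions. -/
def UnsplitablePF (a : W) : Prop :=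
  IsPF a ∧ a ≠ [] ∧
    ¬ ∃ b c : W, IsPF b ∧ IsPF c ∧ b ≠ [] ∧ c ≠ [] ∧ a = splitProd b c

/-- The slash product `a | b = (b₁+m) ⋯ (bₙ+m) a₁ ⋯ a_m`. -/
def slashProd (a b : W) : W := shiftW a.length b ++ a

/-- A nonempty parking function is atomic if it is not the slash product
of two nonempty parking functions. -/
def AtomicPF (a : W) : Prop :=
  IsPF a ∧ a ≠ [] ∧
    ¬ ∃ b c : W, IsPF b ∧ IsPF c ∧ b ≠ [] ∧ c ≠ [] ∧ a = slashProd b c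

/-- `u ≺* v` : either `v` is a proper initial subword of `u`, or `u` is not a
proper initial subword of `v` and `u` precedes `v` lexicographically. -/
def precStar (u v : W) : Prop :=
  (v <+: u ∧ v ≠ u) ∨ (¬ (u <+: v ∧ u ≠ v) ∧ List.Lex (· < ·) u v)

/-- `a ≺*_lex b` : `F_a` strictly precedes `F_b` in the lexicographic order
on sequences of words induced by `≺*`. -/
def precStarLex (a b : W) : Prop := List.Lex precStar (LR a) (LR b)

/-- The covering relation of `≤_*` : `b` covers `a` if `F_b` is obtained from
`F_a = (w_1, …, w_r)` by replacing `w_i` by `w_i ⬝ w_j` and removing `w_j`,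
for some `i < j` such that every letter of `w_i` is at most every letter of `w_j`. -/
def CovStar (a b : W) : Prop :=
  ∃ i j, i < j ∧ j < (LR a).length ∧
    (∀ x ∈ (LR a).getD i [], ∀ y ∈ (LR a).getD j [], x ≤ y) ∧
    LR b = ((LR a).set i ((LR a).getD i [] ++ (LR a).getD j [])).eraseIdx j

/-- The partial order `≤_*` on parking functions, generated by the covering
relations. -/
def leStar (a b : W) : Prop := Relation.ReflTransGen CovStar a b

/-- The finite set of all parking functions of length `n`. -/
noncomputable def pfFinset (n : ℕ) : Finset W :=
  ((Finset.univ : Finset (Fin n → Fin n)).image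
      (fun f => List.ofFn fun i => (f i).val + 1)).filter IsPF

/-- The basis element `Q_a = Σ_{a ≤_* b} M_b`. -/
noncomputable def Qb (K : Type) [Field K] (a : W) : FW K :=
  ∑ b ∈ (pfFinset a.length).filter (fun b => leStar a b), Mb K b

/-- `Q_x ⊗ Q_y` as an element of the tensor square. -/
noncomputable def QT (K : Type) [Field K] (x y : W) : FW2 K :=
  ∑ b ∈ (pfFinset x.length).filter (fun b => leStar x b),
    ∑ c ∈ (pfFinset y.length).filter (fun c => leStar y c),
      Finsupp.single (b, c) 1

/-- `a` is a nonincreasing word. -/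
def NonInc (a : W) : Prop := a.Chain' (fun x y => y ≤ x)

/-- Every word of the LR-decomposition of `a` is nondecreasing. -/
def Nprop (a : W) : Prop := ∀ w ∈ LR a, w.Chain' (· ≤ ·)

/-- The words of the LR-decomposition of `a` have pairwise disjoint sets of letters. -/
def Dprop (a : W) : Prop := (LR a).Pairwise (fun u v => ∀ x ∈ u, x ∉ v)

/-- `a` is a permutation of `{1, …, n}` viewed as a word. -/
def Sprop (a : W) : Prop := a.Perm (List.range' 1 a.length)


/-- The set `X(a,b)` of triples `(Θ, c', c'')` with `Θ ∈ R(a,b)` and `(c', c'')`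
an ordered pair of subwords of `aΘb` with `F_{c'} ⊍ F_{c''} = F_{aΘb}`. -/
def Xab (a b : W) : Set (Finset (W × W) × W × W) :=
  {t | t.1 ∈ Rset a b ∧
    (LR t.2.1).toFinset ∩ (LR t.2.2).toFinset = ∅ ∧
    (LR t.2.1).toFinset ∪ (LR t.2.2).toFinset = (LR (mTheta a b t.1)).toFinset}

/-- The set `Y(a,b)` of tuples `(a', a'', b', b'', Θ', Θ'')` with
`F_{a'} ⊍ F_{a''} = F_a`, `F_{b'} ⊍ F_{b''} = F_b`,
`Θ' ∈ R(Park a', Park b')` and `Θ'' ∈ R(Park a'', Park b'')`. -/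
def Yab (a b : W) : Set (W × W × W × W × Finset (W × W) × Finset (W × W)) :=
  {y | (LR y.1).toFinset ∩ (LR y.2.1).toFinset = ∅ ∧
    (LR y.1).toFinset ∪ (LR y.2.1).toFinset = (LR a).toFinset ∧
    (LR y.2.2.1).toFinset ∩ (LR y.2.2.2.1).toFinset = ∅ ∧
    (LR y.2.2.1).toFinset ∪ (LR y.2.2.2.1).toFinset = (LR b).toFinset ∧
    y.2.2.2.2.1 ∈ Rset (Park y.1) (Park y.2.2.1) ∧
    y.2.2.2.2.2 ∈ Rset (Park y.2.1) (Park y.2.2.2.1)}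


/-! ### LR-decompositions -/

/-- The set of words of the LR-decomposition. -/
def Lf (c : W) : Finset W := (LR c).toFinset

/-- A list of words which is the list of segments of a word. -/
def SegList (S : List W) : Prop :=
  (∀ w ∈ S, Dominated w) ∧ S.Pairwise (fun u v => v.headD 0 < u.headD 0)

theorem segs_flatten (c : W) : (segs c).flatten = c := by
  induction c using segs.induct with
  | case1 => simp [segs]
  | case2 x xs ih => rw [segs]; simp [ih]

theorem mem_segs_sub {c w : W} (h : w ∈ segs c) {x : ℕ} (hx : x ∈ w) : x ∈ c := by
  rw [← segs_flatten c]; exact List.mem_flatten.2 ⟨w, h, hx⟩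

theorem segs_segList (c : W) : SegList (segs c) := by
  induction c using segs.induct with
  | case1 => simp [segs, SegList]
  | case2 x xs ih =>
    rw [segs]
    refine ⟨?_, ?_⟩
    · intro w hw
      rcases List.mem_cons.1 hw with rfl | hw
      · refine ⟨by simp, ?_⟩
        intro y hy
        rcases List.mem_cons.1 hy with rfl | hy
        · simp
        · have := List.mem_takeWhile_imp hy
          simpa using this
      · exact ih.1 w hw
    · refine List.pairwise_cons.2 ⟨?_, ih.2⟩
      intro w hw
      -- the head of the remaining word
      have key : ∀ (l : W), (∀ h : l ≠ [], l.head h < x) → ∀ w ∈ segs l, w.headD 0 < x := by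
        intro l hl w hw
        cases l with
        | nil => simp [segs] at hw
        | cons y ys =>
          have h1 := hl (by simp)
          have h3 := segs_segList_aux y ys w hw
          simp at h1
          omega
      refine key _ ?_ w hw
      intro h
      have := List.head_dropWhile_not (p := fun y => decide (x ≤ y)) (l := xs) h
      simpa using this
where
  segs_segList_aux (y : ℕ) (ys : W) (w : W) (hw : w ∈ segs (y :: ys)) : w.headD 0 ≤ y := by
    have gen : ∀ c : W, ∀ w ∈ segs c, w.headD 0 ≤ c.headD 0 := by
      intro c
      induction c using segs.induct with
      | case1 => simp [segs]
      | case2 x xs ih =>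
        intro w hw
        rw [segs] at hw
        rcases List.mem_cons.1 hw with rfl | hw
        · simp
        · have h1 := ih w hw
          by_cases h : List.dropWhile (fun y => decide (x ≤ y)) xs = []
          · rw [h] at hw; simp [segs] at hw
          · have h2 := List.head_dropWhile_not (p := fun y => decide (x ≤ y)) (l := xs) h
            have h3 : (List.dropWhile (fun y => decide (x ≤ y)) xs).headD 0
              = (List.dropWhile (fun y => decide (x ≤ y)) xs).head h := by
              rw [List.headD_eq_head?_getD, List.head?_eq_some_head h]; rfl
            rw [h3] at h1
            have h4 : ¬ (x ≤ (List.dropWhile (fun y => decide (x ≤ y)) xs).head h) := by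
              simpa using h2
            have h5 : ∀ l : W, (x :: l).headD 0 = x := fun l => rfl
            rw [h5]
            omega
    simpa using gen _ w hw

theorem segs_of_segList {S : List W} (h : SegList S) : segs S.flatten = S := by
  induction S with
  | nil => simp [segs]
  | cons w S ih =>
    obtain ⟨h1, h2⟩ := h
    have hw := h1 w (by simp)
    cases w with
    | nil => exact absurd rfl hw.1
    | cons x xs =>
      have h2' := List.pairwise_cons.1 h2
      have ihS := ih ⟨fun w hw => h1 w (by simp [hw]), h2'.2⟩
      have hxs : ∀ y ∈ xs, decide (x ≤ y) = true := by
        intro y hy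
        have := hw.2 y (by simp [hy])
        simpa using this
      have hd : ∀ y ys, S.flatten = y :: ys → ¬ (x ≤ y) := by
        intro y ys hS
        cases S with
        | nil => simp at hS
        | cons v S =>
          have hv := h1 v (by simp)
          cases v with
          | nil => exact absurd rfl hv.1
          | cons z zs =>
            have := h2'.1 (z :: zs) (by simp)
            simp at hS this
            omega
      have e1 : List.takeWhile (fun y => decide (x ≤ y)) (xs ++ S.flatten) = xs := by
        rw [List.takeWhile_append_of_pos hxs]
        cases hS : S.flatten with
        | nil => simp
        | cons y ys =>
          have := hd y ys hS
          simp [this]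
      have e2 : List.dropWhile (fun y => decide (x ≤ y)) (xs ++ S.flatten) = S.flatten := by
        rw [List.dropWhile_append_of_pos hxs]
        cases hS : S.flatten with
        | nil => simp
        | cons y ys =>
          have := hd y ys hS
          simp [this]
      rw [List.flatten_cons, List.cons_append, segs, e1, e2, ihS]

/-- A set of words which is the LR-decomposition of some word. -/
def Good (G : Finset W) : Prop :=
  (∀ w ∈ G, Dominated w) ∧ ∀ u ∈ G, ∀ v ∈ G, u.headD 0 = v.headD 0 → u = v

theorem mem_Lf {c w : W} : w ∈ Lf c ↔ w ∈ segs c := by simp [Lf, LR]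

theorem Good.mono {G H : Finset W} (h : Good G) (s : H ⊆ G) : Good H :=
  ⟨fun w hw => h.1 w (s hw), fun u hu v hv => h.2 u (s hu) v (s hv)⟩

theorem good_Lf (c : W) : Good (Lf c) := by
  have h := segs_segList c
  refine ⟨fun w hw => h.1 w (mem_Lf.1 hw), ?_⟩
  intro u hu v hv e
  by_contra hne
  rw [mem_Lf] at hu hv
  have := h.2.imp (S := fun u v => u.headD 0 ≠ v.headD 0) (fun h => by omega)
  have hsymm : Std.Symm (fun u v : W => u.headD 0 ≠ v.headD 0) := ⟨fun _ _ h => h.symm⟩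
  exact this.forall hu hv hne e

theorem Lf_inj {c d : W} (h : Lf c = Lf d) : c = d := by
  have hc := segs_segList c
  have hd := segs_segList d
  have nd : ∀ c : W, (segs c).Nodup := fun c =>
    (segs_segList c).2.imp (fun h e => by subst e; omega)
  have hp : (segs c).Perm (segs d) := by
    rw [List.perm_ext_iff_of_nodup (nd c) (nd d)]
    intro w
    rw [← mem_Lf, ← mem_Lf, h]
  have : segs c = segs d := by
    refine hp.eq_of_pairwise ?_ hc.2 hd.2
    intro a b _ _ h1 h2
    omega
  rw [← segs_flatten c, this, segs_flatten]

theorem headD_le_of_le {u v : W} (hu : u ≠ []) (h : u ≤ v) : u.headD 0 ≤ v.headD 0 := by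
  cases u with
  | nil => exact absurd rfl hu
  | cons x xs =>
    cases v with
    | nil => exact absurd h (by simp)
    | cons y ys =>
      by_contra hlt
      have hlt' : y < x := by simpa using hlt
      exact absurd h (not_le_of_gt (List.Lex.rel hlt'))

theorem segs_wordOfSet {G : Finset W} (h : Good G) :
    segs (wordOfSet G) = (G.sort (· ≤ ·)).reverse := by
  unfold wordOfSet
  apply segs_of_segList
  refine ⟨fun w hw => h.1 w (by simpa using hw), ?_⟩
  rw [List.pairwise_reverse]
  have h1 : (G.sort (· ≤ ·)).Pairwise (fun u v => u ≤ v) := Finset.pairwise_sort G (· ≤ ·)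
  have h2 : (G.sort (· ≤ ·)).Nodup := Finset.sort_nodup G (· ≤ ·)
  refine List.Pairwise.imp_of_mem ?_ (h1.and h2)
  intro u v hu hv huv
  have hu' : u ∈ G := by simpa using hu
  have hv' : v ∈ G := by simpa using hv
  have h3 := headD_le_of_le (h.1 u hu').1 huv.1
  have h4 : u.headD 0 ≠ v.headD 0 := fun e => huv.2 (h.2 u hu' v hv' e)
  omega

theorem Lf_wordOfSet {G : Finset W} (h : Good G) : Lf (wordOfSet G) = G := by
  ext w
  rw [mem_Lf, segs_wordOfSet h]
  simp

theorem wordOfSet_Lf (c : W) : wordOfSet (Lf c) = c :=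
  Lf_inj (Lf_wordOfSet (good_Lf c))

theorem segs_map (c : W) (φ : ℕ → ℕ) (h : StrictMonoOn φ {x | x ∈ c}) :
    segs (c.map φ) = (segs c).map (List.map φ) := by
  have hs := segs_segList c
  have e : c.map φ = ((segs c).map (List.map φ)).flatten := by
    rw [← List.map_flatten, segs_flatten]
  rw [e]
  apply segs_of_segList
  have hh : ∀ w ∈ segs c, (w.map φ).headD 0 = φ (w.headD 0) ∧ w.headD 0 ∈ c := by
    intro w hw
    have := (hs.1 w hw).1
    cases w with
    | nil => exact absurd rfl this
    | cons x xs => exact ⟨rfl, mem_segs_sub hw (by simp)⟩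
  refine ⟨?_, ?_⟩
  · intro w hw
    obtain ⟨v, hv, rfl⟩ := List.mem_map.1 hw
    refine ⟨by simpa using (hs.1 v hv).1, ?_⟩
    intro x hx
    obtain ⟨y, hy, rfl⟩ := List.mem_map.1 hx
    rw [(hh v hv).1]
    exact h.monotoneOn (hh v hv).2 (mem_segs_sub hv hy) ((hs.1 v hv).2 y hy)
  · rw [List.pairwise_map]
    refine hs.2.imp_of_mem ?_
    intro u v hu hv huv
    rw [(hh v hv).1, (hh u hu).1]
    exact h (hh v hv).2 (hh u hu).2 huv

theorem Lf_map (c : W) (φ : ℕ → ℕ) (h : StrictMonoOn φ {x | x ∈ c}) :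
    Lf (c.map φ) = (Lf c).image (List.map φ) := by
  ext w
  simp [mem_Lf, segs_map c φ h]

theorem LR_shift (m : ℕ) (c : W) : shiftF m (LR c) = LR (shiftW m c) := by
  unfold shiftF LR shiftW
  rw [segs_map c _ (fun x _ y _ h => by simpa using h), List.map_reverse]

theorem Lf_shift (m : ℕ) (c : W) : Lf (shiftW m c) = (Lf c).image (shiftW m) :=
  Lf_map c _ (fun x _ y _ h => by simpa using h)

theorem shiftW_inj (m : ℕ) : Function.Injective (shiftW m) :=
  List.map_injective_iff.2 (fun x y h => by simpa using h)

theorem coe_eq_sum (c : W) : (c : Multiset ℕ) = ∑ w ∈ Lf c, (w : Multiset ℕ) := by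
  have nd : (segs c).Nodup := (segs_segList c).2.imp (fun h e => by subst e; omega)
  have e : Lf c = (segs c).toFinset := by ext; simp [mem_Lf]
  rw [e, List.sum_toFinset _ nd]
  conv_lhs => rw [← segs_flatten c]
  induction segs c with
  | nil => simp
  | cons u l ih => rw [List.flatten_cons, ← Multiset.coe_add, ih]; simp

theorem sublist_of_Lf {c d : W} (h : Lf c ⊆ Lf d) : c.Sublist d := by
  have hc := (segs_segList c).2
  have hd := (segs_segList d).2
  have nd : (segs c).Nodup := hc.imp (fun h e => by subst e; omega)
  have hs : (segs c).Subperm (segs d) := List.subperm_of_subset nd (fun w hw =>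
    mem_Lf.1 (h (mem_Lf.2 hw)))
  obtain ⟨l, hl, hl'⟩ := hs
  have : l = segs c := by
    refine hl.eq_of_pairwise ?_ (hd.sublist hl') hc
    intro a b _ _ h1 h2
    omega
  subst this
  have := hl'.flatten
  rwa [segs_flatten, segs_flatten] at this

/-! ### Parkization -/

/-- Number of letters at most `i`. -/
def cnt (c : W) (i : ℕ) : ℕ := (c.filter (fun x => x ≤ i)).length

/-- Total decrement of the letter `x` during parkization. -/
def exc (c : W) (x : ℕ) : ℕ := (Finset.range x).sup (fun i => i - cnt c i)

/-- Image of the letter `x` under parkization. -/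
def pk (c : W) (x : ℕ) : ℕ := x - exc c x

theorem cnt_perm {c d : W} (h : c.Perm d) (i : ℕ) : cnt c i = cnt d i :=
  (h.filter _).length_eq

theorem pk_perm {c d : W} (h : c.Perm d) : pk c = pk d := by
  funext x
  simp only [pk, exc, cnt_perm h]

theorem cnt_append (c d : W) (i : ℕ) : cnt (c ++ d) i = cnt c i + cnt d i := by
  simp [cnt]

theorem cnt_cons (x : ℕ) (c : W) (i : ℕ) :
    cnt (x :: c) i = cnt c i + (if x ≤ i then 1 else 0) := by
  unfold cnt
  rw [List.filter_cons]
  split_ifs <;> simp_all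

theorem cnt_le_length (c : W) (i : ℕ) : cnt c i ≤ c.length := List.length_filter_le _ _

theorem cnt_mono (c : W) {i j : ℕ} (h : i ≤ j) : cnt c i ≤ cnt c j := by
  induction c with
  | nil => simp [cnt]
  | cons x c ih => rw [cnt_cons, cnt_cons]; split_ifs <;> omega

theorem cnt_lt (c : W) {i j x : ℕ} (h : i < x) (h' : x ≤ j) (hx : x ∈ c) : cnt c i < cnt c j := by
  induction c with
  | nil => simp at hx
  | cons y c ih =>
    rw [cnt_cons, cnt_cons]
    rcases List.mem_cons.1 hx with rfl | hx
    · have := cnt_mono c (i := i) (j := j) (by omega)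
      split_ifs <;> omega
    · have := ih hx
      split_ifs <;> omega

theorem cnt_eq_length {c : W} {i : ℕ} (h : ∀ x ∈ c, x ≤ i) : cnt c i = c.length := by
  unfold cnt
  rw [List.filter_eq_self.2]
  simpa using h

theorem le_of_cnt {c : W} {i : ℕ} (h : c.length ≤ cnt c i) {x : ℕ} (hx : x ∈ c) : x ≤ i := by
  by_contra hlt
  have := cnt_lt c (i := i) (j := x) (by omega) le_rfl hx
  have := cnt_le_length c x
  omega

theorem exc_succ (c : W) (x : ℕ) : exc c (x + 1) = max (exc c x) (x - cnt c x) := by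
  simp [exc, Finset.range_add_one, max_comm]

theorem le_exc (c : W) {i x : ℕ} (h : i < x) : i - cnt c i ≤ exc c x :=
  Finset.le_sup (f := fun i => i - cnt c i) (Finset.mem_range.2 h)

theorem exc_le {c : W} {x k : ℕ} (h : ∀ i < x, i - cnt c i ≤ k) : exc c x ≤ k :=
  Finset.sup_le (fun i hi => h i (Finset.mem_range.1 hi))

theorem exc_le_self (c : W) (x : ℕ) : exc c x ≤ x := exc_le (fun i hi => by omega)

theorem pk_le_succ (c : W) (x : ℕ) : pk c x ≤ pk c (x + 1) := by
  unfold pk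
  have h : exc c (x + 1) ≤ exc c x + 1 := by
    rw [exc_succ]
    refine max_le (by omega) ?_
    cases x with
    | zero => omega
    | succ y =>
      have h1 := le_exc c (i := y) (x := y + 1) (by omega)
      have h2 := cnt_mono c (i := y) (j := y + 1) (by omega)
      omega
  omega

theorem pk_mono (c : W) : Monotone (pk c) := monotone_nat_of_le_succ (pk_le_succ c)

theorem pk_letter {c : W} {x : ℕ} (hx : x ∈ c) (h1 : 1 ≤ x) : pk c x < pk c (x + 1) := by
  unfold pk
  have h0 := exc_le_self c x
  have h : exc c (x + 1) ≤ exc c x := by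
    rw [exc_succ]
    refine max_le (by omega) ?_
    obtain ⟨y, rfl⟩ : ∃ y, x = y + 1 := ⟨x - 1, by omega⟩
    have h1 := le_exc c (i := y) (x := y + 1) (by omega)
    have h2 := cnt_lt c (i := y) (j := y + 1) (by omega) le_rfl hx
    omega
  omega

theorem pk_strict {c : W} (h : ∀ x ∈ c, 1 ≤ x) : StrictMonoOn (pk c) {x | x ∈ c} := by
  intro x hx y _ hxy
  exact lt_of_lt_of_le (pk_letter hx (h x hx)) (pk_mono c hxy)

theorem dVal_spec (a : W) : cnt a (dVal a) < dVal a :=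
  Nat.find_spec (p := fun i => (a.filter (fun x => x ≤ i)).length < i) _

theorem dVal_min (a : W) {i : ℕ} (h : i < dVal a) : i ≤ cnt a i := by
  have := Nat.find_min (p := fun i => (a.filter (fun x => x ≤ i)).length < i) _ h
  unfold cnt
  omega

theorem dVal_le (a : W) : dVal a ≤ a.length + 1 :=
  Nat.find_min' (p := fun i => (a.filter (fun x => x ≤ i)).length < i) _
    (Nat.lt_succ_of_le (List.length_filter_le _ _))

theorem dVal_not_mem (a : W) : dVal a ∉ a := by
  intro h
  have h1 := dVal_spec a
  have h2 := dVal_min a (i := dVal a - 1) (by omega)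
  have h3 := cnt_lt a (i := dVal a - 1) (j := dVal a) (by omega) le_rfl h
  omega

theorem cnt_step_lt (a : W) {i : ℕ} (h : i < dVal a) : cnt (parkStep a) i = cnt a i := by
  unfold cnt parkStep
  rw [List.filter_map, List.length_map]
  congr 1
  apply List.filter_congr
  intro x hx
  have : x ≠ dVal a := fun e => dVal_not_mem a (e ▸ hx)
  simp only [Function.comp, decide_eq_decide]
  split_ifs <;> omega

theorem cnt_step_ge (a : W) {i : ℕ} (h : dVal a ≤ i) : cnt (parkStep a) i = cnt a (i + 1) := by
  unfold cnt parkStep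
  rw [List.filter_map, List.length_map]
  congr 1
  apply List.filter_congr
  intro x hx
  have : x ≠ dVal a := fun e => dVal_not_mem a (e ▸ hx)
  simp only [Function.comp, decide_eq_decide]
  split_ifs <;> omega

theorem pk_step (a : W) {x : ℕ} (hx : x ∈ a) :
    pk (parkStep a) (if dVal a < x then x - 1 else x) = pk a x := by
  have hne : x ≠ dVal a := fun e => dVal_not_mem a (e ▸ hx)
  have hd := dVal_spec a
  split_ifs with h
  · have key : exc a x = exc (parkStep a) (x - 1) + 1 := by
      apply le_antisymm
      · apply exc_le
        intro i hi
        rcases lt_trichotomy i (dVal a) with h1 | h1 | h1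
        · have := dVal_min a h1
          omega
        · subst h1
          have h2 := dVal_min a (i := dVal a - 1) (by omega)
          have h3 := cnt_mono a (i := dVal a - 1) (j := dVal a) (by omega)
          omega
        · have h2 := cnt_step_ge a (i := i - 1) (by omega)
          have h3 := le_exc (parkStep a) (i := i - 1) (x := x - 1) (by omega)
          rw [Nat.sub_add_cancel (by omega)] at h2
          omega
      · have h0 : 1 ≤ exc a x := by
          have := le_exc a h
          omega
        have : exc (parkStep a) (x - 1) ≤ exc a x - 1 := by
          apply exc_le
          intro j hj
          by_cases h1 : j < dVal a
          · have h2 := cnt_step_lt a h1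
            have h3 := dVal_min a h1
            omega
          · have h2 := cnt_step_ge a (i := j) (by omega)
            have h3 := le_exc a (i := j + 1) (x := x) (by omega)
            omega
        omega
    unfold pk
    omega
  · have h1 : exc a x ≤ 0 := exc_le (fun i hi => by
      have := dVal_min a (i := i) (by omega)
      omega)
    have h2 : exc (parkStep a) x ≤ 0 := exc_le (fun i hi => by
      have := dVal_min a (i := i) (by omega)
      have := cnt_step_lt a (i := i) (by omega)
      omega)
    unfold pk
    omega

theorem parkStep_sum {a : W} (h : dVal a ≠ a.length + 1) : (parkStep a).sum < a.sum := by
  have hd := dVal_spec a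
  have hle := dVal_le a
  have : ∃ x ∈ a, dVal a < x := by
    by_contra hcon
    push Not at hcon
    have := cnt_eq_length hcon
    omega
  obtain ⟨x, hx, hlt⟩ := this
  unfold parkStep
  generalize dVal a = d at hlt
  clear h hd hle
  have gen : ∀ a : W, (a.map (fun x => if d < x then x - 1 else x)).sum ≤ a.sum := by
    intro a
    induction a with
    | nil => simp
    | cons y a ih => simp; split_ifs <;> omega
  induction a with
  | nil => simp at hx
  | cons y a ih =>
    have := gen a
    rcases List.mem_cons.1 hx with rfl | hx
    · simp [hlt]; omega
    · have := ih hx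
      simp; split_ifs <;> omega

theorem parkFuel_eq (k : ℕ) : ∀ a : W, (∀ x ∈ a, 1 ≤ x) → a.sum ≤ k →
    parkFuel k a = a.map (pk a) := by
  induction k with
  | zero =>
    intro a h hs
    cases a with
    | nil => simp [parkFuel]
    | cons x a =>
      have := h x (by simp)
      simp at hs
      omega
  | succ k ih =>
    intro a h hs
    rw [parkFuel]
    split_ifs with hd
    · symm
      conv_rhs => rw [← List.map_id a]
      apply List.map_congr_left
      intro x hx
      have h1 : x ≤ a.length := le_of_cnt (dVal_min a (by omega)) hx
      have h2 : exc a x ≤ 0 := exc_le (fun i hi => by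
        have := dVal_min a (i := i) (by omega)
        omega)
      simp [pk]
      omega
    · have hsum := parkStep_sum hd
      have hpos := dVal_spec a
      rw [ih (parkStep a) ?_ (by omega)]
      · conv_lhs => rw [parkStep, List.map_map]
        apply List.map_congr_left
        intro x hx
        exact pk_step a hx
      · intro x hx
        obtain ⟨y, hy, rfl⟩ := List.mem_map.1 hx
        have := h y hy
        split_ifs <;> omega

theorem Park_eq {a : W} (h : ∀ x ∈ a, 1 ≤ x) : Park a = a.map (pk a) :=
  parkFuel_eq _ a h le_rfl

theorem IsPF.cnt_ge {a : W} (h : IsPF a) {i : ℕ} (hi : i ≤ a.length) : i ≤ cnt a i := by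
  have hp := List.perm_insertionSort (· ≤ ·) a
  have hl : (a.insertionSort (· ≤ ·)).length = a.length := hp.length_eq
  rw [← cnt_perm hp]
  have hs := h.2
  generalize a.insertionSort (· ≤ ·) = s at hs hl
  rw [← List.take_append_drop i s, cnt_append, cnt_eq_length]
  · simp; omega
  · intro x hx
    obtain ⟨j, hj, rfl⟩ := List.mem_iff_getElem.1 hx
    simp at hj
    have := hs j (by omega)
    rw [List.getD_eq_getElem _ _ (by omega)] at this
    simp
    omega

theorem IsPF.le_length {a : W} (h : IsPF a) {x : ℕ} (hx : x ∈ a) : x ≤ a.length :=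
  le_of_cnt (h.cnt_ge le_rfl) hx

theorem cnt_shift (m : ℕ) (b : W) (i : ℕ) : cnt (shiftW m b) (i + m) = cnt b i := by
  simp [cnt, shiftW, List.filter_map, Function.comp_def]

theorem cnt_shift_zero (m : ℕ) {b : W} (hb : ∀ x ∈ b, 1 ≤ x) {i : ℕ} (h : i ≤ m) :
    cnt (shiftW m b) i = 0 := by
  simp only [cnt, shiftW, List.length_eq_zero_iff, List.filter_eq_nil_iff, List.mem_map]
  rintro _ ⟨y, hy, rfl⟩
  have := hb y hy
  simp
  omega

theorem cnt_sublist {a1 a : W} (h : a1.Sublist a) (i : ℕ) :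
    a1.length + cnt a i ≤ a.length + cnt a1 i := by
  induction h with
  | slnil => simp
  | cons x h ih => rw [cnt_cons]; simp; split_ifs <;> omega
  | cons_cons x h ih => rw [cnt_cons, cnt_cons]; simp; split_ifs <;> omega

theorem pk_low {m : ℕ} {a1 b1 : W} (hb : ∀ x ∈ b1, 1 ≤ x) {x : ℕ} (hx : x ≤ m) :
    pk (a1 ++ shiftW m b1) x = pk a1 x := by
  unfold pk exc
  congr 1
  apply Finset.sup_congr rfl
  intro i hi
  have := Finset.mem_range.1 hi
  rw [cnt_append, cnt_shift_zero m hb (by omega), add_zero]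

theorem pk_high {a a1 b1 : W} (ha : IsPF a) (hs : a1.Sublist a) (hb : ∀ x ∈ b1, 1 ≤ x)
    {x : ℕ} (hx : 1 ≤ x) :
    pk (a1 ++ shiftW a.length b1) (x + a.length) = pk b1 x + a1.length := by
  have hlen := hs.length_le
  have hle : ∀ y ∈ a1, y ≤ a.length := fun y hy => ha.le_length (hs.subset hy)
  have key : exc (a1 ++ shiftW a.length b1) (x + a.length)
      = exc b1 x + (a.length - a1.length) := by
    have hc : ∀ j, cnt (a1 ++ shiftW a.length b1) (j + a.length) = a1.length + cnt b1 j := by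
      intro j
      rw [cnt_append, cnt_shift, cnt_eq_length (fun y hy => by have := hle y hy; omega)]
    apply le_antisymm
    · apply exc_le
      intro i hi
      by_cases him : i < a.length
      · have h1 := ha.cnt_ge him.le
        have h2 := cnt_sublist hs i
        rw [cnt_append]
        omega
      · obtain ⟨j, rfl⟩ : ∃ j, i = j + a.length := ⟨i - a.length, by omega⟩
        rw [hc]
        have := le_exc b1 (i := j) (x := x) (by omega)
        omega
    · have h0 : a.length - a1.length ≤ exc (a1 ++ shiftW a.length b1) (x + a.length) := by
        have h1 := le_exc (a1 ++ shiftW a.length b1) (i := 0 + a.length) (x := x + a.length)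
          (by omega)
        rw [hc] at h1
        have h2 : cnt b1 0 = 0 := by
          simp only [cnt, List.length_eq_zero_iff, List.filter_eq_nil_iff]
          intro y hy
          have := hb y hy
          simp; omega
        omega
      have : exc b1 x ≤ exc (a1 ++ shiftW a.length b1) (x + a.length)
          - (a.length - a1.length) := by
        apply exc_le
        intro j hj
        have h1 := le_exc (a1 ++ shiftW a.length b1) (i := j + a.length) (x := x + a.length)
          (by omega)
        rw [hc] at h1
        omega
      omega
  have := exc_le_self b1 x
  unfold pk
  omega

theorem Park_low {a a1 b1 : W} (ha : IsPF a) (hs : a1.Sublist a) (hb : ∀ x ∈ b1, 1 ≤ x) :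
    Park a1 = a1.map (pk (a1 ++ shiftW a.length b1)) := by
  rw [Park_eq (fun x hx => ha.1 x (hs.subset hx))]
  apply List.map_congr_left
  intro x hx
  rw [pk_low hb (ha.le_length (hs.subset hx))]

theorem Park_high {a a1 b1 : W} (ha : IsPF a) (hs : a1.Sublist a) (hb : ∀ x ∈ b1, 1 ≤ x) :
    shiftW a1.length (Park b1) = (shiftW a.length b1).map (pk (a1 ++ shiftW a.length b1)) := by
  rw [Park_eq hb]
  unfold shiftW
  rw [List.map_map, List.map_map]
  apply List.map_congr_left
  intro x hx
  exact (pk_high ha hs hb (hb x hx)).symm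

theorem Park_length {a : W} (h : ∀ x ∈ a, 1 ≤ x) : (Park a).length = a.length := by
  rw [Park_eq h, List.length_map]

/-! ### Glueing along matchings -/

/-- `Θ` is a matching between `A` and `B`. -/
def Mat (A B : Finset W) (Θ : Finset (W × W)) : Prop :=
  (∀ p ∈ Θ, p.1 ∈ A ∧ p.2 ∈ B) ∧ ∀ p ∈ Θ, ∀ q ∈ Θ, (p.1 = q.1 ∨ p.2 = q.2) → p = q

/-- The letters of the words in `A` are at most `m`, those of words in `B` greater than `m`. -/
def LSep (m : ℕ) (A B : Finset W) : Prop :=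
  (∀ u ∈ A, u ≠ [] ∧ ∀ x ∈ u, x ≤ m) ∧ (∀ v ∈ B, v ≠ [] ∧ ∀ x ∈ v, m < x)

/-- The letters at most `m`. -/
def lo (m : ℕ) (w : W) : W := w.filter (fun x => x ≤ m)
/-- The letters greater than `m`. -/
def hi (m : ℕ) (w : W) : W := w.filter (fun x => m < x)

/-- The pair `(u, v)` gives the word `u ++ v` of the glued set. -/
def KK (A B : Finset W) (Θ : Finset (W × W)) (u v : W) : Prop :=
  (u, v) ∈ Θ ∨ (u ∈ A ∧ v = [] ∧ ∀ p ∈ Θ, p.1 ≠ u) ∨ (u = [] ∧ v ∈ B ∧ ∀ p ∈ Θ, p.2 ≠ v)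

theorem mem_glueSet {A B : Finset W} {Θ : Finset (W × W)} {w : W} :
    w ∈ glueSet A B Θ ↔ ∃ u v, w = u ++ v ∧ KK A B Θ u v := by
  unfold glueSet KK
  simp only [Finset.mem_union, Finset.mem_image, Finset.mem_filter]
  constructor
  · rintro ((⟨p, hp, rfl⟩ | ⟨h1, h2⟩) | ⟨h1, h2⟩)
    · exact ⟨p.1, p.2, rfl, Or.inl hp⟩
    · exact ⟨w, [], by simp, Or.inr (Or.inl ⟨h1, rfl, h2⟩)⟩
    · exact ⟨[], w, by simp, Or.inr (Or.inr ⟨rfl, h1, h2⟩)⟩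
  · rintro ⟨u, v, rfl, h | ⟨h1, rfl, h2⟩ | ⟨rfl, h1, h2⟩⟩
    · exact Or.inl (Or.inl ⟨(u, v), h, rfl⟩)
    · exact Or.inl (Or.inr ⟨by simpa using h1, by simpa using h2⟩)
    · exact Or.inr ⟨by simpa using h1, by simpa using h2⟩

theorem LSep.lohi {m : ℕ} {A B : Finset W} (h : LSep m A B) {u v : W}
    (hu : u ∈ A ∨ u = []) (hv : v ∈ B ∨ v = []) : lo m (u ++ v) = u ∧ hi m (u ++ v) = v := by
  have h1 : ∀ x ∈ u, x ≤ m := by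
    rcases hu with hu | rfl
    · exact (h.1 u hu).2
    · simp
  have h2 : ∀ x ∈ v, m < x := by
    rcases hv with hv | rfl
    · exact (h.2 v hv).2
    · simp
  unfold lo hi
  rw [List.filter_append, List.filter_append]
  have e1 : u.filter (fun x => x ≤ m) = u := List.filter_eq_self.2 (by simpa using h1)
  have e2 : v.filter (fun x => m < x) = v := List.filter_eq_self.2 (by simpa using h2)
  have e3 : u.filter (fun x => m < x) = [] := List.filter_eq_nil_iff.2 (by simpa using h1)
  have e4 : v.filter (fun x => x ≤ m) = [] := List.filter_eq_nil_iff.2 (by simpa using h2)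
  simp [e1, e2, e3, e4]

theorem KK.mem {A B : Finset W} {Θ : Finset (W × W)} (hM : Mat A B Θ) {u v : W}
    (h : KK A B Θ u v) : (u ∈ A ∨ u = []) ∧ (v ∈ B ∨ v = []) := by
  rcases h with h | ⟨h1, rfl, h2⟩ | ⟨rfl, h1, h2⟩
  · exact ⟨Or.inl (hM.1 _ h).1, Or.inl (hM.1 _ h).2⟩
  · exact ⟨Or.inl h1, Or.inr rfl⟩
  · exact ⟨Or.inr rfl, Or.inl h1⟩

theorem mem_glue_iff {m : ℕ} {A B : Finset W} {Θ : Finset (W × W)} (hS : LSep m A B)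
    (hM : Mat A B Θ) {w : W} :
    w ∈ glueSet A B Θ ↔ w = lo m w ++ hi m w ∧ KK A B Θ (lo m w) (hi m w) := by
  rw [mem_glueSet]
  constructor
  · rintro ⟨u, v, rfl, h⟩
    have h' := h.mem hM
    have e := hS.lohi h'.1 h'.2
    rw [e.1, e.2]
    exact ⟨rfl, h⟩
  · rintro ⟨h1, h2⟩
    exact ⟨_, _, h1, h2⟩

/-- Membership of `u ++ v` in the glued set. -/
theorem append_mem_glue {m : ℕ} {A B : Finset W} {Θ : Finset (W × W)} (hS : LSep m A B)
    (hM : Mat A B Θ) {u v : W} (hu : u ∈ A ∨ u = []) (hv : v ∈ B ∨ v = []) :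
    u ++ v ∈ glueSet A B Θ ↔ KK A B Θ u v := by
  rw [mem_glue_iff hS hM, (hS.lohi hu hv).1, (hS.lohi hu hv).2]
  simp

theorem LSep.nil {m : ℕ} {A B : Finset W} (h : LSep m A B) : [] ∉ A ∧ [] ∉ B :=
  ⟨fun h' => (h.1 _ h').1 rfl, fun h' => (h.2 _ h').1 rfl⟩

theorem KK.left {A B : Finset W} {Θ : Finset (W × W)} {u : W} (hu : u ∈ A) :
    ∃ v, KK A B Θ u v := by
  by_cases h : ∃ p ∈ Θ, p.1 = u
  · obtain ⟨p, hp, rfl⟩ := h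
    exact ⟨p.2, Or.inl hp⟩
  · push Not at h
    exact ⟨[], Or.inr (Or.inl ⟨hu, rfl, h⟩)⟩

theorem KK.right {A B : Finset W} {Θ : Finset (W × W)} {v : W} (hv : v ∈ B) :
    ∃ u, KK A B Θ u v := by
  by_cases h : ∃ p ∈ Θ, p.2 = v
  · obtain ⟨p, hp, rfl⟩ := h
    exact ⟨p.1, Or.inl hp⟩
  · push Not at h
    exact ⟨[], Or.inr (Or.inr ⟨rfl, hv, h⟩)⟩

theorem KK.uniq_left {A B : Finset W} {Θ : Finset (W × W)} (hM : Mat A B Θ) {u v v' : W}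
    (hu : u ≠ []) (h : KK A B Θ u v) (h' : KK A B Θ u v') : v = v' := by
  rcases h with h | ⟨h1, rfl, h2⟩ | ⟨rfl, h1, h2⟩
  · rcases h' with h' | ⟨h1', rfl, h2'⟩ | ⟨rfl, h1', h2'⟩
    · exact congrArg Prod.snd (hM.2 _ h _ h' (Or.inl rfl))
    · exact absurd rfl (h2' _ h)
    · exact absurd rfl hu
  · rcases h' with h' | ⟨h1', rfl, h2'⟩ | ⟨rfl, h1', h2'⟩
    · exact absurd rfl (h2 _ h')
    · rfl
    · exact absurd rfl hu
  · exact absurd rfl hu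

theorem KK.uniq_right {A B : Finset W} {Θ : Finset (W × W)} (hM : Mat A B Θ) {u u' v : W}
    (hv : v ≠ []) (h : KK A B Θ u v) (h' : KK A B Θ u' v) : u = u' := by
  rcases h with h | ⟨h1, rfl, h2⟩ | ⟨rfl, h1, h2⟩
  · rcases h' with h' | ⟨h1', rfl, h2'⟩ | ⟨rfl, h1', h2'⟩
    · exact congrArg Prod.fst (hM.2 _ h _ h' (Or.inr rfl))
    · exact absurd rfl hv
    · exact absurd rfl (h2' _ h)
  · exact absurd rfl hv
  · rcases h' with h' | ⟨h1', rfl, h2'⟩ | ⟨rfl, h1', h2'⟩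
    · exact absurd rfl (h2 _ h')
    · exact absurd rfl hv
    · rfl

theorem mem_A_iff {m : ℕ} {A B : Finset W} {Θ : Finset (W × W)} (hS : LSep m A B)
    (hM : Mat A B Θ) {u : W} : u ∈ A ↔ u ≠ [] ∧ ∃ w ∈ glueSet A B Θ, lo m w = u := by
  constructor
  · intro hu
    obtain ⟨v, hv⟩ := KK.left (B := B) (Θ := Θ) hu
    have h := hv.mem hM
    exact ⟨(hS.1 u hu).1, u ++ v, (append_mem_glue hS hM h.1 h.2).2 hv, (hS.lohi h.1 h.2).1⟩
  · rintro ⟨hne, w, hw, rfl⟩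
    have h := ((mem_glue_iff hS hM).1 hw).2.mem hM
    exact h.1.resolve_right hne

theorem mem_B_iff {m : ℕ} {A B : Finset W} {Θ : Finset (W × W)} (hS : LSep m A B)
    (hM : Mat A B Θ) {v : W} : v ∈ B ↔ v ≠ [] ∧ ∃ w ∈ glueSet A B Θ, hi m w = v := by
  constructor
  · intro hv
    obtain ⟨u, hu⟩ := KK.right (A := A) (Θ := Θ) hv
    have h := hu.mem hM
    exact ⟨(hS.2 v hv).1, u ++ v, (append_mem_glue hS hM h.1 h.2).2 hu, (hS.lohi h.1 h.2).2⟩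
  · rintro ⟨hne, w, hw, rfl⟩
    have h := ((mem_glue_iff hS hM).1 hw).2.mem hM
    exact h.2.resolve_right hne

theorem mem_Θ_iff {m : ℕ} {A B : Finset W} {Θ : Finset (W × W)} (hS : LSep m A B)
    (hM : Mat A B Θ) {u v : W} :
    (u, v) ∈ Θ ↔ u ≠ [] ∧ v ≠ [] ∧ ∃ w ∈ glueSet A B Θ, lo m w = u ∧ hi m w = v := by
  constructor
  · intro hp
    have h := hM.1 _ hp
    exact ⟨(hS.1 u h.1).1, (hS.2 v h.2).1, u ++ v,
      (append_mem_glue hS hM (Or.inl h.1) (Or.inl h.2)).2 (Or.inl hp),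
      hS.lohi (Or.inl h.1) (Or.inl h.2)⟩
  · rintro ⟨hne, hne', w, hw, rfl, rfl⟩
    rcases ((mem_glue_iff hS hM).1 hw).2 with h | h | h
    · exact h
    · exact absurd h.2.1 hne'
    · exact absurd h.1 hne

theorem glue_inj {m : ℕ} {A B A' B' : Finset W} {Θ Θ' : Finset (W × W)} (hS : LSep m A B)
    (hM : Mat A B Θ) (hS' : LSep m A' B') (hM' : Mat A' B' Θ')
    (h : glueSet A B Θ = glueSet A' B' Θ') : A = A' ∧ B = B' ∧ Θ = Θ' := by
  refine ⟨?_, ?_, ?_⟩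
  · ext u; rw [mem_A_iff hS hM, mem_A_iff hS' hM', h]
  · ext u; rw [mem_B_iff hS hM, mem_B_iff hS' hM', h]
  · ext ⟨u, v⟩; rw [mem_Θ_iff hS hM, mem_Θ_iff hS' hM', h]

theorem LSep.mono {m : ℕ} {A B A' B' : Finset W} (h : LSep m A B) (hA : A' ⊆ A) (hB : B' ⊆ B) :
    LSep m A' B' :=
  ⟨fun u hu => h.1 u (hA hu), fun v hv => h.2 v (hB hv)⟩

theorem glue_sub {m : ℕ} {A B C : Finset W} {Θ : Finset (W × W)} (hS : LSep m A B)
    (hM : Mat A B Θ) (hC : C ⊆ glueSet A B Θ) :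
    Mat (A.filter (fun u => ∃ w ∈ C, lo m w = u)) (B.filter (fun v => ∃ w ∈ C, hi m w = v))
      (Θ.filter (fun p => p.1 ++ p.2 ∈ C)) ∧
    C = glueSet (A.filter (fun u => ∃ w ∈ C, lo m w = u))
      (B.filter (fun v => ∃ w ∈ C, hi m w = v)) (Θ.filter (fun p => p.1 ++ p.2 ∈ C)) := by
  have hlo := fun (p : W × W) (hp : p ∈ Θ) =>
    hS.lohi (Or.inl (hM.1 p hp).1) (Or.inl (hM.1 p hp).2)
  have hM1 : Mat (A.filter (fun u => ∃ w ∈ C, lo m w = u))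
      (B.filter (fun v => ∃ w ∈ C, hi m w = v)) (Θ.filter (fun p => p.1 ++ p.2 ∈ C)) := by
    refine ⟨?_, ?_⟩
    · intro p hp
      rw [Finset.mem_filter] at hp
      simp only [Finset.mem_filter]
      exact ⟨⟨(hM.1 p hp.1).1, _, hp.2, (hlo p hp.1).1⟩, (hM.1 p hp.1).2, _, hp.2, (hlo p hp.1).2⟩
    · intro p hp q hq
      exact hM.2 p (Finset.mem_filter.1 hp).1 q (Finset.mem_filter.1 hq).1
  refine ⟨hM1, ?_⟩
  have hS1 := hS.mono (Finset.filter_subset (fun u => ∃ w ∈ C, lo m w = u) A)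
    (Finset.filter_subset (fun v => ∃ w ∈ C, hi m w = v) B)
  ext w
  rw [mem_glue_iff hS1 hM1]
  constructor
  · intro hw
    have h := (mem_glue_iff hS hM).1 (hC hw)
    refine ⟨h.1, ?_⟩
    rcases h.2 with h2 | ⟨h2, h3, h4⟩ | ⟨h2, h3, h4⟩
    · exact Or.inl (Finset.mem_filter.2 ⟨h2, by rw [← h.1]; exact hw⟩)
    · exact Or.inr (Or.inl ⟨Finset.mem_filter.2 ⟨h2, w, hw, rfl⟩, h3,
        fun p hp => h4 p (Finset.mem_filter.1 hp).1⟩)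
    · exact Or.inr (Or.inr ⟨h2, Finset.mem_filter.2 ⟨h3, w, hw, rfl⟩,
        fun p hp => h4 p (Finset.mem_filter.1 hp).1⟩)
  · rintro ⟨h0, h2 | ⟨h2, h3, h4⟩ | ⟨h2, h3, h4⟩⟩
    · have := (Finset.mem_filter.1 h2).2
      rwa [← h0] at this
    · obtain ⟨h5, w', hw', h6⟩ := Finset.mem_filter.1 h2
      have h := (mem_glue_iff hS hM).1 (hC hw')
      have h7 : hi m w' = [] := by
        rcases h.2 with h2 | h2 | h2
        · exact absurd h6 (h4 (lo m w', hi m w') (Finset.mem_filter.2 ⟨h2, by rw [← h.1]; exact hw'⟩))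
        · exact h2.2.1
        · exact absurd (h6.symm.trans h2.1) (hS.1 _ h5).1
      have : w = w' := by rw [h0, h.1, h6, h7, h3]
      rwa [this]
    · obtain ⟨h5, w', hw', h6⟩ := Finset.mem_filter.1 h3
      have h := (mem_glue_iff hS hM).1 (hC hw')
      have h7 : lo m w' = [] := by
        rcases h.2 with h2 | h2 | h2
        · exact absurd h6 (h4 (lo m w', hi m w') (Finset.mem_filter.2 ⟨h2, by rw [← h.1]; exact hw'⟩))
        · exact absurd (h6.symm.trans h2.2.1) (hS.2 _ h5).1
        · exact h2.1
      have : w = w' := by rw [h0, h.1, h6, h7, h2]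
      rwa [this]

theorem glue_split {m : ℕ} {A B C1 C2 : Finset W} {Θ : Finset (W × W)} (hS : LSep m A B)
    (hM : Mat A B Θ) (hd : C1 ∩ C2 = ∅) (hu : C1 ∪ C2 = glueSet A B Θ) :
    ∃ A1 A2 B1 B2 : Finset W, ∃ Θ1 Θ2 : Finset (W × W),
      A1 ∩ A2 = ∅ ∧ A1 ∪ A2 = A ∧ B1 ∩ B2 = ∅ ∧ B1 ∪ B2 = B ∧ Θ = Θ1 ∪ Θ2 ∧
      Mat A1 B1 Θ1 ∧ Mat A2 B2 Θ2 ∧ C1 = glueSet A1 B1 Θ1 ∧ C2 = glueSet A2 B2 Θ2 := by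
  have hC1 : C1 ⊆ glueSet A B Θ := hu ▸ Finset.subset_union_left
  have hC2 : C2 ⊆ glueSet A B Θ := hu ▸ Finset.subset_union_right
  obtain ⟨m1, e1⟩ := glue_sub hS hM hC1
  obtain ⟨m2, e2⟩ := glue_sub hS hM hC2
  have hdis : ∀ w ∈ C1, w ∉ C2 := fun w h1 h2 => by
    have : w ∈ C1 ∩ C2 := Finset.mem_inter.2 ⟨h1, h2⟩
    rw [hd] at this
    simp at this
  have hun : ∀ w ∈ glueSet A B Θ, w ∈ C1 ∨ w ∈ C2 := fun w hw => by
    rw [← hu] at hw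
    exact Finset.mem_union.1 hw
  refine ⟨_, _, _, _, _, _, ?_, ?_, ?_, ?_, ?_, m1, m2, e1, e2⟩
  · rw [Finset.eq_empty_iff_forall_notMem]
    intro u hu'
    simp only [Finset.mem_inter, Finset.mem_filter] at hu'
    obtain ⟨⟨h1, w, hw, h2⟩, -, w', hw', h3⟩ := hu'
    have k := (mem_glue_iff hS hM).1 (hC1 hw)
    have k' := (mem_glue_iff hS hM).1 (hC2 hw')
    have e := KK.uniq_left hM (hS.1 u h1).1 (h2 ▸ k.2) (h3 ▸ k'.2)
    have : w = w' := by rw [k.1, k'.1, h2, h3, e]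
    exact hdis w hw (this ▸ hw')
  · rw [← Finset.filter_or]
    apply Finset.filter_true_of_mem
    intro u h1
    obtain ⟨-, w, hw, h2⟩ := (mem_A_iff hS hM).1 h1
    exact (hun w hw).imp (fun h => ⟨w, h, h2⟩) (fun h => ⟨w, h, h2⟩)
  · rw [Finset.eq_empty_iff_forall_notMem]
    intro u hu'
    simp only [Finset.mem_inter, Finset.mem_filter] at hu'
    obtain ⟨⟨h1, w, hw, h2⟩, -, w', hw', h3⟩ := hu'
    have k := (mem_glue_iff hS hM).1 (hC1 hw)
    have k' := (mem_glue_iff hS hM).1 (hC2 hw')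
    have e := KK.uniq_right hM (hS.2 u h1).1 (h2 ▸ k.2) (h3 ▸ k'.2)
    have : w = w' := by rw [k.1, k'.1, h2, h3, e]
    exact hdis w hw (this ▸ hw')
  · rw [← Finset.filter_or]
    apply Finset.filter_true_of_mem
    intro u h1
    obtain ⟨-, w, hw, h2⟩ := (mem_B_iff hS hM).1 h1
    exact (hun w hw).imp (fun h => ⟨w, h, h2⟩) (fun h => ⟨w, h, h2⟩)
  · rw [← Finset.filter_or]
    symm
    apply Finset.filter_true_of_mem
    intro p hp
    exact hun _ (mem_glueSet.2 ⟨p.1, p.2, rfl, Or.inl hp⟩)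

theorem glue_union {m : ℕ} {A1 A2 B1 B2 : Finset W} {Θ1 Θ2 : Finset (W × W)}
    (hS : LSep m (A1 ∪ A2) (B1 ∪ B2)) (hA : A1 ∩ A2 = ∅) (hB : B1 ∩ B2 = ∅)
    (h1 : Mat A1 B1 Θ1) (h2 : Mat A2 B2 Θ2) :
    Mat (A1 ∪ A2) (B1 ∪ B2) (Θ1 ∪ Θ2) ∧ glueSet A1 B1 Θ1 ∩ glueSet A2 B2 Θ2 = ∅ ∧
    glueSet A1 B1 Θ1 ∪ glueSet A2 B2 Θ2 = glueSet (A1 ∪ A2) (B1 ∪ B2) (Θ1 ∪ Θ2) := by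
  have hdA : ∀ w ∈ A1, w ∉ A2 := fun w h1 h2 => by
    have : w ∈ A1 ∩ A2 := Finset.mem_inter.2 ⟨h1, h2⟩
    rw [hA] at this
    simp at this
  have hdB : ∀ w ∈ B1, w ∉ B2 := fun w h1 h2 => by
    have : w ∈ B1 ∩ B2 := Finset.mem_inter.2 ⟨h1, h2⟩
    rw [hB] at this
    simp at this
  have hS1 : LSep m A1 B1 := hS.mono Finset.subset_union_left Finset.subset_union_left
  have hS2 : LSep m A2 B2 := hS.mono Finset.subset_union_right Finset.subset_union_right
  have hM : Mat (A1 ∪ A2) (B1 ∪ B2) (Θ1 ∪ Θ2) := by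
    refine ⟨?_, ?_⟩
    · intro p hp
      rcases Finset.mem_union.1 hp with hp | hp
      · exact ⟨Finset.mem_union_left _ (h1.1 p hp).1, Finset.mem_union_left _ (h1.1 p hp).2⟩
      · exact ⟨Finset.mem_union_right _ (h2.1 p hp).1, Finset.mem_union_right _ (h2.1 p hp).2⟩
    · intro p hp q hq e
      rcases Finset.mem_union.1 hp with hp | hp <;> rcases Finset.mem_union.1 hq with hq | hq
      · exact h1.2 p hp q hq e
      · rcases e with e | e
        · exact absurd (e ▸ (h2.1 q hq).1) (hdA _ (h1.1 p hp).1)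
        · exact absurd (e ▸ (h2.1 q hq).2) (hdB _ (h1.1 p hp).2)
      · rcases e with e | e
        · exact absurd (e ▸ (h2.1 p hp).1) (hdA _ (h1.1 q hq).1)
        · exact absurd (e ▸ (h2.1 p hp).2) (hdB _ (h1.1 q hq).2)
      · exact h2.2 p hp q hq e
  refine ⟨hM, ?_, ?_⟩
  · rw [Finset.eq_empty_iff_forall_notMem]
    intro w hw
    rw [Finset.mem_inter, mem_glue_iff hS1 h1, mem_glue_iff hS2 h2] at hw
    have k1 := hw.1.2
    have k2 := hw.2.2
    have m1 := k1.mem h1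
    have m2 := k2.mem h2
    have n1 := hS1.nil
    have n2 := hS2.nil
    have x1 := hdA (lo m w)
    have x2 := hdB (hi m w)
    rcases k1 with k1 | ⟨k1, k1', -⟩ | ⟨k1, k1', -⟩
    · exact (m2.1.elim (x1 (h1.1 _ k1).1) (fun e => n1.1 (e ▸ (h1.1 _ k1).1)))
    · exact (m2.1.elim (x1 k1) (fun e => n1.1 (e ▸ k1)))
    · exact (m2.2.elim (x2 k1') (fun e => n1.2 (e ▸ k1')))
  · ext w
    rw [Finset.mem_union, mem_glue_iff hS1 h1, mem_glue_iff hS2 h2, mem_glue_iff hS hM]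
    generalize lo m w = u
    generalize hi m w = v
    unfold KK
    simp only [Finset.mem_union]
    have f1 := fun p hp => h1.1 p hp
    have f2 := fun p hp => h2.1 p hp
    constructor
    · rintro (⟨e, k | ⟨k, k', k''⟩ | ⟨k, k', k''⟩⟩ | ⟨e, k | ⟨k, k', k''⟩ | ⟨k, k', k''⟩⟩)
      · exact ⟨e, Or.inl (Or.inl k)⟩
      · refine ⟨e, Or.inr (Or.inl ⟨Or.inl k, k', ?_⟩)⟩
        rintro p (hp | hp)
        · exact k'' p hp
        · rintro rfl; exact hdA _ k (h2.1 p hp).1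
      · refine ⟨e, Or.inr (Or.inr ⟨k, Or.inl k', ?_⟩)⟩
        rintro p (hp | hp)
        · exact k'' p hp
        · rintro rfl; exact hdB _ k' (h2.1 p hp).2
      · exact ⟨e, Or.inl (Or.inr k)⟩
      · refine ⟨e, Or.inr (Or.inl ⟨Or.inr k, k', ?_⟩)⟩
        rintro p (hp | hp)
        · rintro rfl; exact hdA _ (h1.1 p hp).1 k
        · exact k'' p hp
      · refine ⟨e, Or.inr (Or.inr ⟨k, Or.inr k', ?_⟩)⟩
        rintro p (hp | hp)
        · rintro rfl; exact hdB _ (h1.1 p hp).2 k'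
        · exact k'' p hp
    · rintro ⟨e, (k | k) | ⟨k | k, k', k''⟩ | ⟨k, k' | k', k''⟩⟩
      · exact Or.inl ⟨e, Or.inl k⟩
      · exact Or.inr ⟨e, Or.inl k⟩
      · exact Or.inl ⟨e, Or.inr (Or.inl ⟨k, k', fun p hp => k'' p (Or.inl hp)⟩)⟩
      · exact Or.inr ⟨e, Or.inr (Or.inl ⟨k, k', fun p hp => k'' p (Or.inr hp)⟩)⟩
      · exact Or.inl ⟨e, Or.inr (Or.inr ⟨k, k', fun p hp => k'' p (Or.inl hp)⟩)⟩
      · exact Or.inr ⟨e, Or.inr (Or.inr ⟨k, k', fun p hp => k'' p (Or.inr hp)⟩)⟩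

theorem headD_append_of_ne {u v : W} (h : u ≠ []) : (u ++ v).headD 0 = u.headD 0 := by
  cases u with
  | nil => exact absurd rfl h
  | cons x xs => rfl

theorem headD_mem {u : W} (h : u ≠ []) : u.headD 0 ∈ u := by
  cases u with
  | nil => exact absurd rfl h
  | cons x xs => simp

theorem good_glue {m : ℕ} {A B : Finset W} {Θ : Finset (W × W)} (hS : LSep m A B)
    (hM : Mat A B Θ) (hA : Good A) (hB : Good B) : Good (glueSet A B Θ) := by
  -- each word either starts with a word of `A` or is a word of `B`
  have cs : ∀ {u v}, KK A B Θ u v → (u ∈ A ∧ (v ∈ B ∨ v = [])) ∨ (u = [] ∧ v ∈ B) := by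
    intro u v h
    rcases h with h | h | h
    · exact Or.inl ⟨(hM.1 _ h).1, Or.inl (hM.1 _ h).2⟩
    · exact Or.inl ⟨h.1, Or.inr h.2.1⟩
    · exact Or.inr ⟨h.1, h.2.1⟩
  refine ⟨?_, ?_⟩
  · intro w hw
    obtain ⟨u, v, rfl, h⟩ := mem_glueSet.1 hw
    rcases cs h with ⟨h1, h2⟩ | ⟨rfl, h1⟩
    · have hu := hA.1 u h1
      refine ⟨by simp [hu.1], ?_⟩
      intro x hx
      rw [headD_append_of_ne hu.1]
      rcases List.mem_append.1 hx with hx | hx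
      · exact hu.2 x hx
      · have h3 := (hS.1 u h1).2 _ (headD_mem hu.1)
        rcases h2 with h2 | rfl
        · have := (hS.2 v h2).2 x hx
          omega
        · simp at hx
    · exact hB.1 v h1
  · intro w hw w' hw' e
    obtain ⟨u, v, rfl, h⟩ := mem_glueSet.1 hw
    obtain ⟨u', v', rfl, h'⟩ := mem_glueSet.1 hw'
    rcases cs h with ⟨h1, -⟩ | ⟨rfl, h1⟩ <;> rcases cs h' with ⟨h1', -⟩ | ⟨rfl, h1'⟩
    · rw [headD_append_of_ne (hA.1 u h1).1, headD_append_of_ne (hA.1 u' h1').1] at e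
      have := hA.2 u h1 u' h1' e
      subst this
      rw [KK.uniq_left hM (hA.1 u h1).1 h h']
    · rw [headD_append_of_ne (hA.1 u h1).1, List.nil_append] at e
      have h3 := (hS.1 u h1).2 _ (headD_mem (hA.1 u h1).1)
      have h4 := (hS.2 v' h1').2 _ (headD_mem (hB.1 v' h1').1)
      omega
    · rw [headD_append_of_ne (hA.1 u' h1').1, List.nil_append] at e
      have h3 := (hS.1 u' h1').2 _ (headD_mem (hA.1 u' h1').1)
      have h4 := (hS.2 v h1).2 _ (headD_mem (hB.1 v h1).1)
      omega
    · exact hB.2 v h1 v' h1' e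

theorem glue_image {A B : Finset W} {Θ : Finset (W × W)} (hM : Mat A B Θ) (φ : ℕ → ℕ)
    (hA : Set.InjOn (List.map φ) (A : Set W)) (hB : Set.InjOn (List.map φ) (B : Set W)) :
    glueSet (A.image (List.map φ)) (B.image (List.map φ))
      (Θ.image (Prod.map (List.map φ) (List.map φ))) = (glueSet A B Θ).image (List.map φ) := by
  ext w
  rw [mem_glueSet, Finset.mem_image]
  constructor
  · rintro ⟨u, v, rfl, h | ⟨h1, rfl, h2⟩ | ⟨rfl, h1, h2⟩⟩
    · obtain ⟨p, hp, e⟩ := Finset.mem_image.1 h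
      simp only [Prod.map, Prod.mk.injEq] at e
      refine ⟨p.1 ++ p.2, mem_glueSet.2 ⟨_, _, rfl, Or.inl hp⟩, ?_⟩
      rw [List.map_append, e.1, e.2]
    · obtain ⟨u', hu', rfl⟩ := Finset.mem_image.1 h1
      refine ⟨u' ++ [], mem_glueSet.2 ⟨_, _, rfl, Or.inr (Or.inl ⟨hu', rfl, ?_⟩)⟩, by simp⟩
      rintro p hp rfl
      exact h2 _ (Finset.mem_image_of_mem _ hp) rfl
    · obtain ⟨u', hu', rfl⟩ := Finset.mem_image.1 h1
      refine ⟨[] ++ u', mem_glueSet.2 ⟨_, _, rfl, Or.inr (Or.inr ⟨rfl, hu', ?_⟩)⟩, by simp⟩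
      rintro p hp rfl
      exact h2 _ (Finset.mem_image_of_mem _ hp) rfl
  · rintro ⟨w', hw', rfl⟩
    obtain ⟨u, v, rfl, h | ⟨h1, rfl, h2⟩ | ⟨rfl, h1, h2⟩⟩ := mem_glueSet.1 hw'
    · exact ⟨u.map φ, v.map φ, List.map_append, Or.inl (Finset.mem_image.2 ⟨(u, v), h, rfl⟩)⟩
    · refine ⟨u.map φ, [], by simp, Or.inr (Or.inl ⟨Finset.mem_image_of_mem _ h1, rfl, ?_⟩)⟩
      intro p hp e
      obtain ⟨q, hq, rfl⟩ := Finset.mem_image.1 hp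
      exact h2 q hq (hA (hM.1 q hq).1 h1 e)
    · refine ⟨[], v.map φ, by simp, Or.inr (Or.inr ⟨rfl, Finset.mem_image_of_mem _ h1, ?_⟩)⟩
      intro p hp e
      obtain ⟨q, hq, rfl⟩ := Finset.mem_image.1 hp
      exact h2 q hq (hB (hM.1 q hq).2 h1 e)

theorem mat_image {A B : Finset W} {Θ : Finset (W × W)} (hM : Mat A B Θ) (ψ : W → W)
    (hA : Set.InjOn ψ (A : Set W)) (hB : Set.InjOn ψ (B : Set W)) :
    Mat (A.image ψ) (B.image ψ) (Θ.image (Prod.map ψ ψ)) := by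
  refine ⟨?_, ?_⟩
  · intro p hp
    obtain ⟨q, hq, rfl⟩ := Finset.mem_image.1 hp
    exact ⟨Finset.mem_image_of_mem _ (hM.1 q hq).1, Finset.mem_image_of_mem _ (hM.1 q hq).2⟩
  · intro p hp p' hp' e
    obtain ⟨q, hq, rfl⟩ := Finset.mem_image.1 hp
    obtain ⟨q', hq', rfl⟩ := Finset.mem_image.1 hp'
    rw [hM.2 q hq q' hq' (e.imp (fun e => hA (hM.1 q hq).1 (hM.1 q' hq').1 e)
      (fun e => hB (hM.1 q hq).2 (hM.1 q' hq').2 e))]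

theorem mat_preimage {A B : Finset W} {Θ' : Finset (W × W)} (ψ : W → W)
    (hA : Set.InjOn ψ (A : Set W)) (hB : Set.InjOn ψ (B : Set W))
    (hM : Mat (A.image ψ) (B.image ψ) Θ') :
    ∃ Θ, Mat A B Θ ∧ Θ' = Θ.image (Prod.map ψ ψ) := by
  refine ⟨(A ×ˢ B).filter (fun p => Prod.map ψ ψ p ∈ Θ'), ⟨?_, ?_⟩, ?_⟩
  · intro p hp
    simpa using (Finset.mem_filter.1 hp).1
  · intro p hp q hq e
    simp only [Finset.mem_filter, Finset.mem_product] at hp hq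
    have := hM.2 _ hp.2 _ hq.2 (e.imp (fun e => congrArg ψ e) (fun e => congrArg ψ e))
    simp only [Prod.map, Prod.mk.injEq] at this
    exact Prod.ext (hA hp.1.1 hq.1.1 this.1) (hB hp.1.2 hq.1.2 this.2)
  · ext p
    simp only [Finset.mem_image, Finset.mem_filter, Finset.mem_product]
    constructor
    · intro hp
      have h := hM.1 p hp
      obtain ⟨u, hu, e⟩ := Finset.mem_image.1 h.1
      obtain ⟨v, hv, e'⟩ := Finset.mem_image.1 h.2
      have : Prod.map ψ ψ (u, v) = p := Prod.ext e e'
      exact ⟨(u, v), ⟨⟨hu, hv⟩, by rw [this]; exact hp⟩, this⟩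
    · rintro ⟨q, ⟨-, h⟩, rfl⟩
      exact h

theorem mat_image_inj {A B : Finset W} {Θ1 Θ2 : Finset (W × W)} (h1 : Mat A B Θ1)
    (h2 : Mat A B Θ2) (ψ : W → W)
    (hA : Set.InjOn ψ (A : Set W)) (hB : Set.InjOn ψ (B : Set W))
    (e : Θ1.image (Prod.map ψ ψ) = Θ2.image (Prod.map ψ ψ)) : Θ1 = Θ2 := by
  have gen : ∀ {Θ1 Θ2 : Finset (W × W)}, Mat A B Θ1 → Mat A B Θ2 →
      Θ1.image (Prod.map ψ ψ) = Θ2.image (Prod.map ψ ψ) → Θ1 ⊆ Θ2 := by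
    intro Θ1 Θ2 h1 h2 e p hp
    have : Prod.map ψ ψ p ∈ Θ2.image (Prod.map ψ ψ) := e ▸ Finset.mem_image_of_mem _ hp
    obtain ⟨q, hq, e'⟩ := Finset.mem_image.1 this
    simp only [Prod.map, Prod.mk.injEq] at e'
    have : q = p := Prod.ext (hA (h2.1 q hq).1 (h1.1 p hp).1 e'.1)
      (hB (h2.1 q hq).2 (h1.1 p hp).2 e'.2)
    exact this ▸ hq
  exact Finset.Subset.antisymm (gen h1 h2 e) (gen h2 h1 e.symm)

theorem glue_sum {m : ℕ} {A B : Finset W} {Θ : Finset (W × W)} (hS : LSep m A B)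
    (hM : Mat A B Θ) :
    ∑ w ∈ glueSet A B Θ, (w : Multiset ℕ)
      = ∑ u ∈ A, (u : Multiset ℕ) + ∑ v ∈ B, (v : Multiset ℕ) := by
  have lh := fun (p : W × W) (hp : p ∈ Θ) =>
    hS.lohi (Or.inl (hM.1 p hp).1) (Or.inl (hM.1 p hp).2)
  have lA := fun (u : W) (hu : u ∈ A) => hS.lohi (v := []) (Or.inl hu) (Or.inr rfl)
  have lB := fun (v : W) (hv : v ∈ B) => hS.lohi (u := []) (Or.inr rfl) (Or.inl hv)
  simp only [List.append_nil] at lA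
  simp only [List.nil_append] at lB
  unfold glueSet
  rw [Finset.sum_union, Finset.sum_union, Finset.sum_image]
  · have e1 : A.filter (fun u => ¬ ∀ p ∈ Θ, p.1 ≠ u) = Θ.image Prod.fst := by
      ext u
      simp only [Finset.mem_filter, Finset.mem_image]
      push Not
      exact ⟨fun h => h.2, fun ⟨p, hp, e⟩ => ⟨e ▸ (hM.1 p hp).1, p, hp, e⟩⟩
    have e2 : B.filter (fun u => ¬ ∀ p ∈ Θ, p.2 ≠ u) = Θ.image Prod.snd := by
      ext u
      simp only [Finset.mem_filter, Finset.mem_image]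
      push Not
      exact ⟨fun h => h.2, fun ⟨p, hp, e⟩ => ⟨e ▸ (hM.1 p hp).2, p, hp, e⟩⟩
    rw [← Finset.sum_filter_add_sum_filter_not A (fun u => ∀ p ∈ Θ, p.1 ≠ u),
      ← Finset.sum_filter_add_sum_filter_not B (fun u => ∀ p ∈ Θ, p.2 ≠ u), e1, e2,
      Finset.sum_image (fun p hp q hq e => hM.2 p hp q hq (Or.inl e)),
      Finset.sum_image (fun p hp q hq e => hM.2 p hp q hq (Or.inr e))]
    simp only [← Multiset.coe_add, Finset.sum_add_distrib]
    abel
  · intro p hp q hq e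
    have e' : p.1 ++ p.2 = q.1 ++ q.2 := e
    refine hM.2 p hp q hq (Or.inl ?_)
    rw [← (lh p hp).1, ← (lh q hq).1, e']
  · rw [Finset.disjoint_left]
    intro w hw hw'
    obtain ⟨p, hp, rfl⟩ := Finset.mem_image.1 hw
    have h := (Finset.mem_filter.1 hw').1
    have := (lA _ h).2
    rw [(lh p hp).2] at this
    exact (hS.2 _ (hM.1 p hp).2).1 this
  · rw [Finset.disjoint_left]
    intro w hw hw'
    have h := (Finset.mem_filter.1 hw').1
    have h1 := (lB _ h).1
    rcases Finset.mem_union.1 hw with hw | hw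
    · obtain ⟨p, hp, rfl⟩ := Finset.mem_image.1 hw
      rw [(lh p hp).1] at h1
      exact (hS.1 _ (hM.1 p hp).1).1 h1
    · have h2 := (Finset.mem_filter.1 hw).1
      rw [(lA _ h2).1] at h1
      exact (hS.1 _ h2).1 h1

/-! ### The bijection -/

theorem mem_Rset {a b : W} {Θ : Finset (W × W)} :
    Θ ∈ Rset a b ↔ Mat (Lf a) (Lf (shiftW a.length b)) Θ := by
  unfold Rset Mat Lf
  rw [LR_shift, Finset.mem_filter, Finset.mem_powerset]
  apply and_congr_left'
  constructor
  · intro h p hp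
    exact Finset.mem_product.1 (h hp)
  · intro h p hp
    exact Finset.mem_product.2 (h p hp)

theorem mTheta_eq (a b : W) (Θ : Finset (W × W)) :
    mTheta a b Θ = wordOfSet (glueSet (Lf a) (Lf (shiftW a.length b)) Θ) := by
  unfold mTheta Lf
  rw [LR_shift]

theorem sep_ab {a b : W} (ha : IsPF a) (hb : IsPF b) :
    LSep a.length (Lf a) (Lf (shiftW a.length b)) := by
  refine ⟨?_, ?_⟩
  · intro u hu
    exact ⟨((good_Lf a).1 u hu).1, fun x hx => ha.le_length (mem_segs_sub (mem_Lf.1 hu) hx)⟩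
  · intro v hv
    refine ⟨((good_Lf _).1 v hv).1, fun x hx => ?_⟩
    have := mem_segs_sub (mem_Lf.1 hv) hx
    obtain ⟨y, hy, rfl⟩ := List.mem_map.1 this
    have := hb.1 y hy
    omega

theorem Lf_shift_mono {m : ℕ} {b1 b : W} (h : Lf b1 ⊆ Lf b) :
    Lf (shiftW m b1) ⊆ Lf (shiftW m b) := by
  rw [Lf_shift, Lf_shift]
  exact Finset.image_subset_image h

theorem map_injOn {φ : ℕ → ℕ} {S : Set ℕ} (h : Set.InjOn φ S) :
    ∀ {u v : W}, (∀ x ∈ u, x ∈ S) → (∀ x ∈ v, x ∈ S) → u.map φ = v.map φ → u = v := by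
  intro u
  induction u with
  | nil => intro v _ _ e; simpa using e.symm
  | cons x u ih =>
    intro v hu hv e
    cases v with
    | nil => simp at e
    | cons y v =>
      simp only [List.map_cons, List.cons.injEq] at e
      rw [h (hu x (by simp)) (hv y (by simp)) e.1,
        ih (fun z hz => hu z (by simp [hz])) (fun z hz => hv z (by simp [hz])) e.2]

/-- The parkization map on words for the pair `a1`, `b1 + m`. -/
def psi (m : ℕ) (a1 b1 : W) : W → W := List.map (pk (a1 ++ shiftW m b1))

/-- One component of the correspondence. -/
def CompR (m : ℕ) (c a1 b1 : W) (Θ1 Θ' : Finset (W × W)) : Prop :=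
  Mat (Lf a1) (Lf (shiftW m b1)) Θ1 ∧ Lf c = glueSet (Lf a1) (Lf (shiftW m b1)) Θ1 ∧
    Θ' = Θ1.image (Prod.map (psi m a1 b1) (psi m a1 b1))

section comp
variable {a b a1 b1 : W}

theorem letters_pos (ha : IsPF a) (hb : IsPF b) (h1 : Lf a1 ⊆ Lf a) (h2 : Lf b1 ⊆ Lf b) :
    ∀ x ∈ a1 ++ shiftW a.length b1, 1 ≤ x := by
  intro x hx
  rcases List.mem_append.1 hx with hx | hx
  · exact ha.1 x ((sublist_of_Lf h1).subset hx)
  · obtain ⟨y, hy, rfl⟩ := List.mem_map.1 hx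
    have := hb.1 y ((sublist_of_Lf h2).subset hy)
    omega

theorem psi_inj (ha : IsPF a) (hb : IsPF b) (h1 : Lf a1 ⊆ Lf a) (h2 : Lf b1 ⊆ Lf b) :
    Set.InjOn (psi a.length a1 b1) (Lf a1 : Set W) ∧
    Set.InjOn (psi a.length a1 b1) (Lf (shiftW a.length b1) : Set W) := by
  have h := (pk_strict (letters_pos ha hb h1 h2)).injOn
  refine ⟨?_, ?_⟩
  · intro u hu v hv e
    refine map_injOn h ?_ ?_ e
    · exact fun x hx => List.mem_append_left _ (mem_segs_sub (mem_Lf.1 hu) hx)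
    · exact fun x hx => List.mem_append_left _ (mem_segs_sub (mem_Lf.1 hv) hx)
  · intro u hu v hv e
    refine map_injOn h ?_ ?_ e
    · exact fun x hx => List.mem_append_right _ (mem_segs_sub (mem_Lf.1 hu) hx)
    · exact fun x hx => List.mem_append_right _ (mem_segs_sub (mem_Lf.1 hv) hx)

theorem Lf_Park (ha : IsPF a) (hb : IsPF b) (h1 : Lf a1 ⊆ Lf a) (h2 : Lf b1 ⊆ Lf b) :
    Lf (Park a1) = (Lf a1).image (psi a.length a1 b1) ∧
    Lf (shiftW (Park a1).length (Park b1))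
      = (Lf (shiftW a.length b1)).image (psi a.length a1 b1) := by
  have hs := sublist_of_Lf h1
  have hpa : ∀ x ∈ a1, 1 ≤ x := fun x hx => ha.1 x (hs.subset hx)
  have hpb : ∀ x ∈ b1, 1 ≤ x := fun x hx => hb.1 x ((sublist_of_Lf h2).subset hx)
  have h := pk_strict (letters_pos ha hb h1 h2)
  rw [Park_length hpa, Park_high ha hs hpb, Park_low ha hs hpb]
  exact ⟨Lf_map _ _ (h.mono (fun x hx => List.mem_append_left _ hx)),
    Lf_map _ _ (h.mono (fun x hx => List.mem_append_right _ hx))⟩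

theorem sep_sub (ha : IsPF a) (hb : IsPF b) (h1 : Lf a1 ⊆ Lf a) (h2 : Lf b1 ⊆ Lf b) :
    LSep a.length (Lf a1) (Lf (shiftW a.length b1)) :=
  (sep_ab ha hb).mono h1 (Lf_shift_mono h2)

theorem comp_mem {c : W} {Θ1 Θ' : Finset (W × W)} (ha : IsPF a) (hb : IsPF b)
    (h1 : Lf a1 ⊆ Lf a) (h2 : Lf b1 ⊆ Lf b) (h : CompR a.length c a1 b1 Θ1 Θ') :
    Θ' ∈ Rset (Park a1) (Park b1) := by
  have hp := Lf_Park ha hb h1 h2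
  have hi := psi_inj ha hb h1 h2
  rw [mem_Rset, hp.1, hp.2, h.2.2]
  exact mat_image h.1 _ hi.1 hi.2

theorem comp_exists {Θ' : Finset (W × W)} (ha : IsPF a) (hb : IsPF b)
    (h1 : Lf a1 ⊆ Lf a) (h2 : Lf b1 ⊆ Lf b) (h : Θ' ∈ Rset (Park a1) (Park b1)) :
    ∃ c Θ1, CompR a.length c a1 b1 Θ1 Θ' := by
  have hp := Lf_Park ha hb h1 h2
  have hi := psi_inj ha hb h1 h2
  rw [mem_Rset, hp.1, hp.2] at h
  obtain ⟨Θ1, hM, e⟩ := mat_preimage _ hi.1 hi.2 h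
  exact ⟨_, Θ1, hM,
    Lf_wordOfSet (good_glue (sep_sub ha hb h1 h2) hM (good_Lf _) (good_Lf _)), e⟩

theorem comp_park {c : W} {Θ1 Θ' : Finset (W × W)} (ha : IsPF a) (hb : IsPF b)
    (h1 : Lf a1 ⊆ Lf a) (h2 : Lf b1 ⊆ Lf b) (h : CompR a.length c a1 b1 Θ1 Θ') :
    Park c = mTheta (Park a1) (Park b1) Θ' := by
  have hp := Lf_Park ha hb h1 h2
  have hi := psi_inj ha hb h1 h2
  have hperm : c.Perm (a1 ++ shiftW a.length b1) := by
    rw [← Multiset.coe_eq_coe, coe_eq_sum c, h.2.1, glue_sum (sep_sub ha hb h1 h2) h.1,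
      ← coe_eq_sum, ← coe_eq_sum, Multiset.coe_add]
  have hpos : ∀ x ∈ c, 1 ≤ x := fun x hx => letters_pos ha hb h1 h2 x (hperm.subset hx)
  rw [mTheta_eq, hp.1, hp.2, h.2.2]
  have e := glue_image h.1 (pk (a1 ++ shiftW a.length b1)) hi.1 hi.2
  have e2 : Lf (Park c) = (Lf c).image (psi a.length a1 b1) := by
    rw [Park_eq hpos, Lf_map _ _ (pk_strict hpos), pk_perm hperm]
    rfl
  rw [← wordOfSet_Lf (Park c), e2, h.2.1]
  exact congrArg wordOfSet e.symm

theorem comp_left {c c' : W} {Θ1 Θ2 Θ' : Finset (W × W)} (ha : IsPF a) (hb : IsPF b)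
    (h1 : Lf a1 ⊆ Lf a) (h2 : Lf b1 ⊆ Lf b) (h : CompR a.length c a1 b1 Θ1 Θ')
    (h' : CompR a.length c' a1 b1 Θ2 Θ') : c = c' ∧ Θ1 = Θ2 := by
  have hi := psi_inj ha hb h1 h2
  have e : Θ1 = Θ2 := mat_image_inj h.1 h'.1 _ hi.1 hi.2 (h.2.2.symm.trans h'.2.2)
  subst e
  exact ⟨Lf_inj (h.2.1.trans h'.2.1.symm), rfl⟩

theorem comp_right {c a2 b2 : W} {Θ1 Θ2 Θ' Θ'' : Finset (W × W)} (ha : IsPF a) (hb : IsPF b)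
    (h1 : Lf a1 ⊆ Lf a) (h2 : Lf b1 ⊆ Lf b) (h1' : Lf a2 ⊆ Lf a) (h2' : Lf b2 ⊆ Lf b)
    (h : CompR a.length c a1 b1 Θ1 Θ')
    (h' : CompR a.length c a2 b2 Θ2 Θ'') : a1 = a2 ∧ b1 = b2 ∧ Θ' = Θ'' := by
  obtain ⟨e1, e2, e3⟩ := glue_inj (sep_sub ha hb h1 h2) h.1 (sep_sub ha hb h1' h2') h'.1
    (h.2.1.symm.trans h'.2.1)
  have e1 := Lf_inj e1
  have e2 := shiftW_inj _ (Lf_inj e2)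
  subst e1 e2 e3
  exact ⟨rfl, rfl, h.2.2.trans h'.2.2.symm⟩

end comp

/-- The correspondence between `X(a,b)` and `Y(a,b)`. -/
def RelXY (m : ℕ) (t : Finset (W × W) × W × W)
    (y : W × W × W × W × Finset (W × W) × Finset (W × W)) : Prop :=
  ∃ Θ1 Θ2, t.1 = Θ1 ∪ Θ2 ∧ CompR m t.2.1 y.1 y.2.2.1 Θ1 y.2.2.2.2.1 ∧
    CompR m t.2.2 y.2.1 y.2.2.2.1 Θ2 y.2.2.2.2.2

theorem Yab_sub {a b : W} {y : W × W × W × W × Finset (W × W) × Finset (W × W)}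
    (hy : y ∈ Yab a b) : Lf y.1 ⊆ Lf a ∧ Lf y.2.1 ⊆ Lf a ∧ Lf y.2.2.1 ⊆ Lf b ∧
      Lf y.2.2.2.1 ⊆ Lf b := by
  obtain ⟨-, h1, -, h2, -, -⟩ := hy
  unfold Lf
  rw [← h1, ← h2]
  exact ⟨Finset.subset_union_left, Finset.subset_union_right, Finset.subset_union_left,
    Finset.subset_union_right⟩

theorem rel_right {a b : W} (ha : IsPF a) (hb : IsPF b) {t : Finset (W × W) × W × W}
    (ht : t ∈ Xab a b) : ∃ y ∈ Yab a b, RelXY a.length t y := by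
  obtain ⟨Θ, c1, c2⟩ := t
  obtain ⟨hR, hd, hu⟩ := ht
  have hM := mem_Rset.1 hR
  have hS := sep_ab ha hb
  have hG := good_glue hS hM (good_Lf _) (good_Lf _)
  have hu' : Lf c1 ∪ Lf c2 = glueSet (Lf a) (Lf (shiftW a.length b)) Θ := by
    rw [← Lf_wordOfSet hG, ← mTheta_eq]; exact hu
  obtain ⟨A1, A2, B1, B2, Θ1, Θ2, hA, hAu, hB, hBu, rfl, hM1, hM2, hC1, hC2⟩ :=
    glue_split hS hM hd hu'
  have sA1 : A1 ⊆ Lf a := hAu ▸ Finset.subset_union_left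
  have sA2 : A2 ⊆ Lf a := hAu ▸ Finset.subset_union_right
  have sB1 : B1 ⊆ Lf (shiftW a.length b) := hBu ▸ Finset.subset_union_left
  have sB2 : B2 ⊆ Lf (shiftW a.length b) := hBu ▸ Finset.subset_union_right
  obtain ⟨a1, ea1⟩ : ∃ a1, Lf a1 = A1 := ⟨_, Lf_wordOfSet ((good_Lf a).mono sA1)⟩
  obtain ⟨a2, ea2⟩ : ∃ a2, Lf a2 = A2 := ⟨_, Lf_wordOfSet ((good_Lf a).mono sA2)⟩
  have exB : ∀ B0 ⊆ Lf (shiftW a.length b), ∃ b1, Lf (shiftW a.length b1) = B0 := by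
    intro B0 hB0
    rw [Lf_shift, Finset.subset_image_iff] at hB0
    obtain ⟨B', hB', e⟩ := hB0
    have hB'' : B' ⊆ Lf b := by exact_mod_cast hB'
    refine ⟨wordOfSet B', ?_⟩
    rw [Lf_shift, Lf_wordOfSet ((good_Lf b).mono hB''), e]
  obtain ⟨b1, eb1⟩ := exB B1 sB1
  obtain ⟨b2, eb2⟩ := exB B2 sB2
  subst ea1 ea2 eb1 eb2
  have hinj := Finset.image_injective (shiftW_inj a.length)
  have hB' : Lf b1 ∩ Lf b2 = ∅ := by
    rw [Lf_shift, Lf_shift, ← Finset.image_inter _ _ (shiftW_inj a.length)] at hB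
    simpa using hB
  have hBu' : Lf b1 ∪ Lf b2 = Lf b := by
    rw [Lf_shift, Lf_shift, Lf_shift, ← Finset.image_union] at hBu
    exact hinj hBu
  have sb1 : Lf b1 ⊆ Lf b := hBu' ▸ Finset.subset_union_left
  have sb2 : Lf b2 ⊆ Lf b := hBu' ▸ Finset.subset_union_right
  have r1 : CompR a.length c1 a1 b1 Θ1 _ := ⟨hM1, hC1, rfl⟩
  have r2 : CompR a.length c2 a2 b2 Θ2 _ := ⟨hM2, hC2, rfl⟩
  exact ⟨(a1, a2, b1, b2, _, _), ⟨hA, hAu, hB', hBu', comp_mem ha hb sA1 sb1 r1,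
    comp_mem ha hb sA2 sb2 r2⟩, Θ1, Θ2, rfl, r1, r2⟩

theorem rel_left {a b : W} (ha : IsPF a) (hb : IsPF b)
    {y : W × W × W × W × Finset (W × W) × Finset (W × W)}
    (hy : y ∈ Yab a b) : ∃ t ∈ Xab a b, RelXY a.length t y := by
  obtain ⟨s1, s2, s3, s4⟩ := Yab_sub hy
  obtain ⟨a1, a2, b1, b2, T1, T2⟩ := y
  obtain ⟨hA, hAu, hB, hBu, hT1, hT2⟩ := hy
  obtain ⟨c1, Θ1, r1⟩ := comp_exists ha hb s1 s3 hT1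
  obtain ⟨c2, Θ2, r2⟩ := comp_exists ha hb s2 s4 hT2
  have hAu' : Lf a1 ∪ Lf a2 = Lf a := hAu
  have hBu' : Lf (shiftW a.length b1) ∪ Lf (shiftW a.length b2) = Lf (shiftW a.length b) := by
    rw [Lf_shift, Lf_shift, Lf_shift, ← Finset.image_union]
    exact congrArg _ hBu
  have hB' : Lf (shiftW a.length b1) ∩ Lf (shiftW a.length b2) = ∅ := by
    rw [Lf_shift, Lf_shift, ← Finset.image_inter _ _ (shiftW_inj a.length),
      Finset.image_eq_empty]
    exact hB
  have hS := sep_ab ha hb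
  have hS' := hS
  rw [← hAu', ← hBu'] at hS'
  obtain ⟨hM, hd, hu⟩ := glue_union hS' hA hB' r1.1 r2.1
  rw [hAu', hBu'] at hM hu
  refine ⟨(Θ1 ∪ Θ2, c1, c2), ⟨mem_Rset.2 hM, ?_, ?_⟩, Θ1, Θ2, rfl, r1, r2⟩
  · change Lf c1 ∩ Lf c2 = ∅
    rw [r1.2.1, r2.2.1]
    exact hd
  · change Lf c1 ∪ Lf c2 = Lf (mTheta a b (Θ1 ∪ Θ2))
    rw [r1.2.1, r2.2.1, mTheta_eq, Lf_wordOfSet (good_glue hS hM (good_Lf _) (good_Lf _))]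
    exact hu

/-- Lemma 3.5 of the paper: there is a bijection
`X(a,b) → Y(a,b)`, `(Θ, c', c'') ↦ (a', a'', b', b'', Θ', Θ'')`, such that
`Park c' = Park(a') Θ' Park(b')` and `Park c'' = Park(a'') Θ'' Park(b'')`. -/
theorem stmt5 (a b : W) (ha : IsPF a) (hb : IsPF b) :
    ∃ f : Finset (W × W) × W × W → W × W × W × W × Finset (W × W) × Finset (W × W),
      Set.BijOn f (Xab a b) (Yab a b) ∧
      ∀ t ∈ Xab a b,
        Park t.2.1 = mTheta (Park (f t).1) (Park (f t).2.2.1) (f t).2.2.2.2.1 ∧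
        Park t.2.2 = mTheta (Park (f t).2.1) (Park (f t).2.2.2.1) (f t).2.2.2.2.2 := by
  have hex : ∀ t, ∃ y, t ∈ Xab a b → y ∈ Yab a b ∧ RelXY a.length t y := by
    intro t
    by_cases ht : t ∈ Xab a b
    · obtain ⟨y, hy, hr⟩ := rel_right ha hb ht
      exact ⟨y, fun _ => ⟨hy, hr⟩⟩
    · exact ⟨([], [], [], [], ∅, ∅), fun h => absurd h ht⟩
  choose f hf using hex
  refine ⟨f, ⟨fun t ht => (hf t ht).1, ?_, ?_⟩, ?_⟩
  · intro t ht t' ht' e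
    obtain ⟨hy, Θ1, Θ2, e0, r1, r2⟩ := hf t ht
    obtain ⟨-, Θ1', Θ2', e0', r1', r2'⟩ := hf t' ht'
    rw [← e] at r1' r2'
    obtain ⟨s1, s2, s3, s4⟩ := Yab_sub hy
    obtain ⟨k1, k2⟩ := comp_left ha hb s1 s3 r1 r1'
    obtain ⟨k3, k4⟩ := comp_left ha hb s2 s4 r2 r2'
    exact Prod.ext (by rw [e0, e0', k2, k4]) (Prod.ext k1 k3)
  · intro y hy
    obtain ⟨t, ht, Θ1, Θ2, e0, r1, r2⟩ := rel_left ha hb hy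
    refine ⟨t, ht, ?_⟩
    obtain ⟨hy', Θ1', Θ2', e0', r1', r2'⟩ := hf t ht
    obtain ⟨s1, s2, s3, s4⟩ := Yab_sub hy
    obtain ⟨s1', s2', s3', s4'⟩ := Yab_sub hy'
    obtain ⟨k1, k2, k3⟩ := comp_right ha hb s1' s3' s1 s3 r1' r1
    obtain ⟨k4, k5, k6⟩ := comp_right ha hb s2' s4' s2 s4 r2' r2
    exact Prod.ext k1 (Prod.ext k4 (Prod.ext k2 (Prod.ext k5 (Prod.ext k3 k6))))
  · intro t ht
    obtain ⟨hy, Θ1, Θ2, e0, r1, r2⟩ := hf t ht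
    obtain ⟨s1, s2, s3, s4⟩ := Yab_sub hy
    exact ⟨comp_park ha hb s1 s3 r1, comp_park ha hb s2 s4 r2⟩
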